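/- Let K ⊂ ℝ^{n+1} be a smooth, strictly convex body with the origin in its interior, support function h, σ_n = 1/𝒦, cone-volume measure dV = hσ_n dμ, and position vector X = Dh = hx + ∇̄h. Then n ∫ |X|² dV ≤ ∫ h(Δ̄h + nh) dV + n |∫ X dV|² / ∫ dV, where Δ̄ is the spherical Laplacian. -/

import Mathlib

open MeasureTheory Metric
open scoped RealInnerProductSpace ENNReal

noncomputable section

abbrev E (n : ℕ) : Type := EuclideanSpace ℝ (Fin (n + 1))

/-- The Hessian of `H` as a continuous linear map. -/
def hess {n : ℕ} (H : E n → ℝ) (x : E n) : E n →L[ℝ] E n :=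
  fderiv ℝ (gradient H) x

/-- The rank-one projection `y ↦ ⟪x, y⟫ • x`. -/
def proj {n : ℕ} (x : E n) : E n →L[ℝ] E n :=
  ((innerSL ℝ) x).smulRight x

/-- `σ_n = det(∇̄²h + h ḡ)/det ḡ = 1/𝒦`, computed as the determinant of
`D²H + x ⊗ x` where `H` is the 1-homogeneous extension of the support function. -/
def sigmaDet {n : ℕ} (H : E n → ℝ) (x : E n) : ℝ :=
  LinearMap.det ((hess H x + proj x) : E n →L[ℝ] E n).toLinearMap

/-- Tangential (spherical) gradient of the restriction to the unit sphere. -/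
def tgrad {n : ℕ} (F : E n → ℝ) (x : E n) : E n :=
  gradient F x - ⟪gradient F x, x⟫ • x

/-- The convex body with support function `H`. -/
def body {n : ℕ} (H : E n → ℝ) : Set (E n) :=
  {y | ∀ x ∈ sphere (0 : E n) 1, ⟪y, x⟫ ≤ H x}

/-- One-dimensional Brunn–Minkowski inequality for midpoints of compact sets. -/
theorem volume_add_volume_le_of_isCompact {K L C : Set ℝ} (hK : IsCompact K) (hL : IsCompact L)
    (hK0 : K.Nonempty) (hL0 : L.Nonempty) (h : ∀ x ∈ K, ∀ y ∈ L, (x + y) / 2 ∈ C) :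
    volume K + volume L ≤ 2 * volume C := by
  obtain ⟨M, hM, hMK⟩ := hK.exists_isGreatest hK0
  obtain ⟨m, hm, hmL⟩ := hL.exists_isLeast hL0
  have half (S : Set ℝ) (a : ℝ) : volume ((fun z : ℝ => 2 * z - a) ⁻¹' S) = volume S / 2 := by
    have : (fun z : ℝ => 2 * z - a) ⁻¹' S = (fun z => 2 * z) ⁻¹' ((fun z => z + -a) ⁻¹' S) := by
      ext z; simp [sub_eq_add_neg]
    rw [this, Real.volume_preimage_mul_left two_ne_zero, measure_preimage_add_right]
    rw [abs_of_pos (by norm_num), ENNReal.ofReal_inv_of_pos two_pos, ENNReal.ofReal_ofNat,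
      ENNReal.div_eq_inv_mul]
  set S := (fun z : ℝ => 2 * z - m) ⁻¹' K with hS
  set T := (fun z : ℝ => 2 * z - M) ⁻¹' L with hT
  have hTm : MeasurableSet T :=
    hL.measurableSet.preimage (by fun_prop)
  have hdisj : AEDisjoint volume S T := by
    refine measure_mono_null (t := {(M + m) / 2}) ?_ (by simp)
    rintro z ⟨hz1, hz2⟩
    have h1 : 2 * z - m ≤ M := hMK hz1
    have h2 : m ≤ 2 * z - M := hmL hz2
    simp only [Set.mem_singleton_iff]
    linarith
  have hsub : S ∪ T ⊆ C := by
    rintro z (hz | hz)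
    · have := h _ hz _ hm
      rwa [show (2 * z - m + m) / 2 = z by ring] at this
    · have := h _ hM _ hz
      rwa [show (M + (2 * z - M)) / 2 = z by ring] at this
  calc volume K + volume L = 2 * (volume S + volume T) := by
        rw [half, half, mul_add, ENNReal.mul_div_cancel two_ne_zero ENNReal.ofNat_ne_top,
          ENNReal.mul_div_cancel two_ne_zero ENNReal.ofNat_ne_top]
    _ = 2 * volume (S ∪ T) := by rw [measure_union₀ hTm.nullMeasurableSet hdisj]
    _ ≤ 2 * volume C := by gcongr

/-- One-dimensional Brunn–Minkowski inequality for midpoints. -/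
theorem volume_add_volume_le {A B C : Set ℝ} (hA : MeasurableSet A) (hB : MeasurableSet B)
    (hA0 : A.Nonempty) (hB0 : B.Nonempty) (h : ∀ x ∈ A, ∀ y ∈ B, (x + y) / 2 ∈ C) :
    volume A + volume B ≤ 2 * volume C := by
  obtain ⟨a, ha⟩ := hA0
  obtain ⟨b, hb⟩ := hB0
  rw [hA.measure_eq_iSup_isCompact, hB.measure_eq_iSup_isCompact]
  simp only [iSup_and']
  refine ENNReal.biSup_add_biSup_le' ⟨∅, by simp⟩ ⟨∅, by simp⟩ ?_
  rintro K ⟨hKA, hK⟩ L ⟨hLB, hL⟩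
  refine le_trans (add_le_add (measure_mono (Set.subset_insert a K))
    (measure_mono (Set.subset_insert b L))) ?_
  refine volume_add_volume_le_of_isCompact (hK.insert a) (hL.insert b) (Set.insert_nonempty _ _)
    (Set.insert_nonempty _ _) fun x hx y hy => h x ?_ y ?_
  · exact Set.insert_subset ha hKA hx
  · exact Set.insert_subset hb hLB hy

theorem ENNReal.mul_le_sq_of_add_le {a b c : ℝ≥0∞} (h : a + b ≤ 2 * c) : a * b ≤ c ^ 2 := by
  by_cases hc : c = ⊤
  · simp [hc]
  have hs : a + b ≠ ⊤ := (h.trans_lt (ENNReal.mul_lt_top (by simp) (lt_top_iff_ne_top.2 hc))).ne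
  lift c to NNReal using hc
  lift a to NNReal using (by simp_all)
  lift b to NNReal using (by simp_all)
  norm_cast at h ⊢
  rw [← NNReal.coe_le_coe] at h ⊢
  push_cast at h ⊢
  nlinarith [sq_nonneg ((a : ℝ) - b), a.2, b.2, c.2, a.coe_nonneg, b.coe_nonneg]

theorem ENNReal.exists_sq_eq_mul {a b : ℝ≥0∞} (ha0 : a ≠ 0) (ha : a ≠ ⊤) (hb0 : b ≠ 0)
    (hb : b ≠ ⊤) : ∃ c : ℝ≥0∞, c ^ 2 = a * b ∧ c ≠ 0 ∧ c ≠ ⊤ := by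
  lift a to NNReal using ha
  lift b to NNReal using hb
  refine ⟨(NNReal.sqrt (a * b) : NNReal), ?_, ?_, by simp⟩
  · norm_cast
    exact NNReal.sq_sqrt _
  · simp only [ne_eq, ENNReal.coe_eq_zero, NNReal.sqrt_eq_zero, mul_eq_zero, not_or] at *
    exact ⟨ha0, hb0⟩

/-- The additive form of the one-dimensional Prékopa–Leindler inequality for functions with
supremum `1`. -/
theorem lintegral_add_lintegral_le {f g h : ℝ → ℝ} (hf : Measurable f) (hg : Measurable g)
    (hh : Measurable h) (hf0 : 0 ≤ f) (hg0 : 0 ≤ g) (hh0 : 0 ≤ h)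
    (hf1 : ∀ x, f x ≤ 1) (hg1 : ∀ x, g x ≤ 1)
    (hfs : ∀ t < 1, ∃ x, t < f x) (hgs : ∀ t < 1, ∃ x, t < g x)
    (H : ∀ t, 0 < t → t < 1 → ∀ x y, t < f x → t < g y → t < h ((x + y) / 2)) :
    (∫⁻ x, ENNReal.ofReal (f x)) + ∫⁻ x, ENNReal.ofReal (g x) ≤
      2 * ∫⁻ x, ENNReal.ofReal (h x) := by
  rw [lintegral_eq_lintegral_meas_lt _ (.of_forall hf0) hf.aemeasurable,
    lintegral_eq_lintegral_meas_lt _ (.of_forall hg0) hg.aemeasurable,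
    lintegral_eq_lintegral_meas_lt _ (.of_forall hh0) hh.aemeasurable,
    ← lintegral_const_mul' _ _ (by simp), ← lintegral_add_left]
  · refine setLIntegral_mono' measurableSet_Ioi fun t (ht : 0 < t) => ?_
    rcases lt_or_ge t 1 with h1 | h1
    · exact volume_add_volume_le (measurableSet_lt measurable_const hf)
        (measurableSet_lt measurable_const hg) (hfs t h1) (hgs t h1)
        fun x hx y hy => H t ht h1 x y hx hy
    · have (u : ℝ → ℝ) (hu : ∀ x, u x ≤ 1) : {x | t < u x} = ∅ := by
        ext x
        simpa using (hu x).trans h1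
      simp [this f hf1, this g hg1]
  · exact Antitone.measurable fun s t hst => measure_mono fun x hx => lt_of_le_of_lt hst hx

theorem prekopaLeindler_real_of_bounded {f g h : ℝ → ℝ≥0∞} (hf : Measurable f) (hg : Measurable g)
    (hh : Measurable h) (hfb : ⨆ x, f x ≠ ⊤) (hgb : ⨆ x, g x ≠ ⊤)
    (H : ∀ x y, f x * g y ≤ h ((x + y) / 2) ^ 2) :
    (∫⁻ x, f x) * ∫⁻ x, g x ≤ (∫⁻ x, h x) ^ 2 := by
  set a := ⨆ x, f x with ha
  set b := ⨆ x, g x with hb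
  have hfa (x) : f x ≤ a := le_iSup f x
  have hgb' (x) : g x ≤ b := le_iSup g x
  rcases eq_or_ne a 0 with ha0 | ha0
  · have : f = 0 := funext fun x => le_antisymm ((hfa x).trans ha0.le) bot_le
    simp [this]
  rcases eq_or_ne b 0 with hb0 | hb0
  · have : g = 0 := funext fun x => le_antisymm ((hgb' x).trans hb0.le) bot_le
    simp [this]
  obtain ⟨c, hc, hc0, hct⟩ := ENNReal.exists_sq_eq_mul ha0 hfb hb0 hgb
  have lt_toReal {u v : ℝ≥0∞} (hv0 : v ≠ 0) (hvt : v ≠ ⊤) (huv : u / v ≠ ⊤) {t : ℝ} (ht : 0 ≤ t) :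
      t < (u / v).toReal ↔ ENNReal.ofReal t * v < u := by
    rw [← ENNReal.ofReal_lt_iff_lt_toReal ht huv,
      ENNReal.lt_div_iff_mul_lt (.inl hv0) (.inl hvt)]
  have div_le_one {u v : ℝ≥0∞} (h : u ≤ v) : u / v ≤ 1 :=
    ENNReal.div_le_of_le_mul (by simpa using h)
  have exists_lt {u : ℝ → ℝ≥0∞} {v : ℝ≥0∞} (hv : v = ⨆ x, u x) (hv0 : v ≠ 0) (hvt : v ≠ ⊤)
      (t : ℝ) (ht : t < 1) : ∃ x, t < (u x / v).toReal := by
    rcases lt_or_ge t 0 with h0 | h0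
    · exact ⟨0, h0.trans_le ENNReal.toReal_nonneg⟩
    have : ENNReal.ofReal t * v < ⨆ x, u x := by
      rw [← hv]
      calc ENNReal.ofReal t * v < 1 * v :=
            (ENNReal.mul_lt_mul_iff_left hv0 hvt).2 (ENNReal.ofReal_lt_one.2 ht)
        _ = v := one_mul v
    obtain ⟨x, hx⟩ := lt_iSup_iff.1 this
    refine ⟨x, (lt_toReal hv0 hvt ?_ h0).2 hx⟩
    exact ((div_le_one (hv ▸ le_iSup u x)).trans_lt ENNReal.one_lt_top).ne
  have hfa1 (x) : f x / a ≤ 1 := div_le_one (hfa x)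
  have hgb1 (x) : g x / b ≤ 1 := div_le_one (hgb' x)
  have hne {u : ℝ≥0∞} (h : u ≤ 1) : u ≠ ⊤ := (h.trans_lt ENNReal.one_lt_top).ne
  have hto {u : ℝ≥0∞} (h : u ≤ 1) : u.toReal ≤ 1 := by
    simpa using ENNReal.toReal_mono ENNReal.one_ne_top h
  have key := lintegral_add_lintegral_le (f := fun x => (f x / a).toReal)
    (g := fun x => (g x / b).toReal) (h := fun x => (min (h x / c) 1).toReal)
    (by fun_prop) (by fun_prop) (by fun_prop) (fun x => ENNReal.toReal_nonneg)
    (fun x => ENNReal.toReal_nonneg) (fun x => ENNReal.toReal_nonneg)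
    (fun x => hto (hfa1 x)) (fun x => hto (hgb1 x)) (exists_lt ha ha0 hfb) (exists_lt hb hb0 hgb)
    (by
      intro t ht ht1 x y hx hy
      rw [lt_toReal ha0 hfb (hne (hfa1 x)) ht.le] at hx
      rw [lt_toReal hb0 hgb (hne (hgb1 y)) ht.le] at hy
      rw [← ENNReal.ofReal_lt_iff_lt_toReal ht.le (hne (min_le_right _ _)), lt_min_iff,
        ENNReal.lt_div_iff_mul_lt (.inl hc0) (.inl hct)]
      refine ⟨?_, ENNReal.ofReal_lt_one.2 ht1⟩
      refine lt_of_not_ge fun hle => (pow_le_pow_left' hle 2).not_gt ?_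
      calc (ENNReal.ofReal t * c) ^ 2 = (ENNReal.ofReal t * a) * (ENNReal.ofReal t * b) := by
            rw [mul_pow, hc]; ring
        _ < f x * g y := ENNReal.mul_lt_mul hx hy
        _ ≤ _ := H x y)
  simp only [ENNReal.ofReal_toReal (hne (hfa1 _)), ENNReal.ofReal_toReal (hne (hgb1 _)),
    ENNReal.ofReal_toReal (hne (min_le_right _ _))] at key
  replace key := key.trans (mul_le_mul_right
    (lintegral_mono (g := fun x => h x / c) fun x => min_le_left _ _) 2)
  simp only [div_eq_mul_inv] at key
  rw [lintegral_mul_const _ hf, lintegral_mul_const _ hg, lintegral_mul_const _ hh] at key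
  have := ENNReal.mul_le_sq_of_add_le key
  rw [mul_pow, ← ENNReal.inv_pow, hc, mul_mul_mul_comm,
    ← ENNReal.mul_inv (.inl ha0) (.inl hfb)] at this
  have hab0 : a * b ≠ 0 := mul_ne_zero ha0 hb0
  have habt : a * b ≠ ⊤ := ENNReal.mul_ne_top hfb hgb
  rwa [ENNReal.mul_le_mul_iff_left (ENNReal.inv_ne_zero.2 habt) (ENNReal.inv_ne_top.2 hab0)]
    at this

/-- The one-dimensional Prékopa–Leindler inequality for midpoints. -/
theorem prekopaLeindler_real {f g h : ℝ → ℝ≥0∞} (hf : Measurable f) (hg : Measurable g)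
    (hh : Measurable h) (H : ∀ x y, f x * g y ≤ h ((x + y) / 2) ^ 2) :
    (∫⁻ x, f x) * ∫⁻ x, g x ≤ (∫⁻ x, h x) ^ 2 := by
  have trunc {u : ℝ → ℝ≥0∞} (hu : Measurable u) :
      ∫⁻ x, u x = ⨆ k : ℕ, ∫⁻ x, min (u x) k := by
    rw [← lintegral_iSup (fun k => hu.min measurable_const)]
    · congr with x
      exact (by rw [← inf_iSup_eq, ENNReal.iSup_natCast, inf_top_eq] :
        ⨆ k : ℕ, u x ⊓ (k : ℝ≥0∞) = u x).symm
    · exact fun k l hkl x => min_le_min_left _ (by exact_mod_cast hkl)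
  have bdd (u : ℝ → ℝ≥0∞) (k : ℕ) : ⨆ x, min (u x) k ≠ ⊤ :=
    ((iSup_le fun x => min_le_right _ _).trans_lt (ENNReal.natCast_lt_top k)).ne
  rw [trunc hf, trunc hg, ENNReal.iSup_mul]
  refine iSup_le fun k => ?_
  rw [ENNReal.mul_iSup]
  refine iSup_le fun l => ?_
  refine prekopaLeindler_real_of_bounded (hf.min measurable_const) (hg.min measurable_const) hh
    (bdd f k) (bdd g l) fun x y => le_trans ?_ (H x y)
  gcongr <;> exact min_le_left _ _

/-- The Prékopa–Leindler inequality for midpoints. -/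
theorem prekopaLeindler_pi (d : ℕ) {f g h : (Fin d → ℝ) → ℝ≥0∞} (hf : Measurable f)
    (hg : Measurable g) (hh : Measurable h)
    (H : ∀ x y, f x * g y ≤ h ((2⁻¹ : ℝ) • (x + y)) ^ 2) :
    (∫⁻ x, f x) * ∫⁻ x, g x ≤ (∫⁻ x, h x) ^ 2 := by
  induction d with
  | zero =>
    have key (x : Fin 0 → ℝ) : f x * g x ≤ h x ^ 2 := by
      convert H x x
    simpa only [volume_pi, lintegral_unique, Measure.pi_univ, Finset.univ_eq_empty,
      Finset.prod_empty, mul_one] using key _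
  | succ d ih =>
    set e := (MeasurableEquiv.piFinSuccAbove (fun _ : Fin (d + 1) => ℝ) 0).symm with he
    have hmp : MeasurePreserving e :=
      (volume_preserving_piFinSuccAbove (fun _ : Fin (d + 1) => ℝ) 0).symm
    have emk (p : ℝ × (Fin d → ℝ)) : e p = Fin.cons p.1 p.2 := by
      simp [he, MeasurableEquiv.piFinSuccAbove, Fin.insertNthEquiv]
    have red {u : (Fin (d + 1) → ℝ) → ℝ≥0∞} (hu : Measurable u) :
        ∫⁻ x, u x = ∫⁻ s, ∫⁻ y, u (e (s, y)) := by
      rw [← hmp.lintegral_comp hu, Measure.volume_eq_prod,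
        lintegral_prod (fun p => u (e p)) (hu.comp e.measurable).aemeasurable]
    have slice {u : (Fin (d + 1) → ℝ) → ℝ≥0∞} (hu : Measurable u) (s : ℝ) :
        Measurable fun y => u (e (s, y)) := hu.comp (e.measurable.comp measurable_prodMk_left)
    have marg {u : (Fin (d + 1) → ℝ) → ℝ≥0∞} (hu : Measurable u) :
        Measurable fun s => ∫⁻ y, u (e (s, y)) :=
      (hu.comp e.measurable).lintegral_prod_right'
    rw [red hf, red hg, red hh]
    refine prekopaLeindler_real (marg hf) (marg hg) (marg hh) fun s t => ?_
    refine ih (slice hf s) (slice hg t) (slice hh _) fun x y => ?_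
    convert H (e (s, x)) (e (t, y)) using 3
    simp only [emk]
    ext i
    refine Fin.cases ?_ (fun j => ?_) i
    · simp; ring
    · simp [mul_add]

/-- The Prékopa–Leindler inequality for midpoints on a Euclidean space. -/
theorem prekopaLeindler (d : ℕ) {f g h : EuclideanSpace ℝ (Fin d) → ℝ≥0∞} (hf : Measurable f)
    (hg : Measurable g) (hh : Measurable h)
    (H : ∀ x y, f x * g y ≤ h ((2⁻¹ : ℝ) • (x + y)) ^ 2) :
    (∫⁻ x, f x) * ∫⁻ x, g x ≤ (∫⁻ x, h x) ^ 2 := by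
  have hmp := (EuclideanSpace.volume_preserving_symm_measurableEquiv_toLp (Fin d)).symm
  rw [← hmp.lintegral_comp hf, ← hmp.lintegral_comp hg, ← hmp.lintegral_comp hh]
  exact prekopaLeindler_pi d (hf.comp hmp.measurable) (hg.comp hmp.measurable)
    (hh.comp hmp.measurable) fun x y => H _ _

open Filter in
/-- One half of Christensen's comparison of uniformly distributed measures. -/
theorem measure_isOpen_le_liminf_mul {X : Type*} [MetricSpace X] [SecondCountableTopology X]
    [MeasurableSpace X] [BorelSpace X] {μ ν : Measure X} [IsFiniteMeasure μ] [IsFiniteMeasure ν]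
    {φ ψ : ℝ → ℝ≥0∞} (hμ : ∀ x r, μ (ball x r) = φ r) (hν : ∀ x r, ν (ball x r) = ψ r)
    (hψ : ∀ r, 0 < r → ψ r ≠ 0) (hψt : ∀ r, ψ r ≠ ⊤) {r : ℕ → ℝ} (hr : ∀ k, 0 < r k)
    (hr0 : Tendsto r atTop (nhds 0)) {U : Set X} (hU : IsOpen U) :
    μ U ≤ liminf (fun k => φ (r k) / ψ (r k)) atTop * ν U := by
  have hS (k) : MeasurableSet {p : X × X | p.2 ∈ U ∧ dist p.2 p.1 < r k} :=
    (measurable_snd hU.measurableSet).inter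
      (measurableSet_lt (measurable_snd.dist measurable_fst) measurable_const)
  have hm (k) : Measurable fun x => ν (U ∩ ball x (r k)) := measurable_measure_prodMk_left (hS k)
  calc μ U = ∫⁻ x in U, 1 ∂μ := (setLIntegral_one U).symm
    _ ≤ ∫⁻ x in U, liminf (fun k => ν (U ∩ ball x (r k)) / ψ (r k)) atTop ∂μ := by
      refine setLIntegral_mono' hU.measurableSet fun x hx => ?_
      obtain ⟨ε, hε, hεU⟩ := Metric.isOpen_iff.1 hU x hx
      refine le_liminf_of_le (by isBoundedDefault) ?_
      filter_upwards [hr0.eventually (gt_mem_nhds hε)] with k hk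
      rw [Set.inter_eq_right.2 ((ball_subset_ball hk.le).trans hεU), hν,
        ENNReal.div_self (hψ _ (hr k)) (hψt _)]
    _ ≤ liminf (fun k => ∫⁻ x in U, ν (U ∩ ball x (r k)) / ψ (r k) ∂μ) atTop :=
      lintegral_liminf_le fun k => (hm k).div_const _
    _ ≤ liminf (fun k => φ (r k) / ψ (r k) * ν U) atTop := by
      refine liminf_le_liminf (.of_forall fun k => ?_)
      simp only [div_eq_mul_inv]
      rw [lintegral_mul_const _ (hm k), mul_right_comm]
      gcongr
      calc ∫⁻ x in U, ν (U ∩ ball x (r k)) ∂μ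
          = ((μ.restrict U).prod ν) {p : X × X | p.2 ∈ U ∧ dist p.2 p.1 < r k} :=
            (Measure.prod_apply (hS k)).symm
        _ = ∫⁻ y, (μ.restrict U) {x | y ∈ U ∧ dist y x < r k} ∂ν :=
            Measure.prod_apply_symm (hS k)
        _ ≤ ∫⁻ y, U.indicator (fun _ => φ (r k)) y ∂ν := by
            refine lintegral_mono fun y => ?_
            by_cases hy : y ∈ U
            · simp only [hy, true_and, Set.indicator_of_mem]
              refine (Measure.restrict_apply_le _ _).trans ?_
              rw [← hμ y]
              exact measure_mono fun x hx => by simpa [dist_comm] using hx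
            · simp [hy]
        _ = φ (r k) * ν U := by
            rw [lintegral_indicator hU.measurableSet, setLIntegral_const]
    _ = liminf (fun k => φ (r k) / ψ (r k)) atTop * ν U :=
      (ENNReal.liminf_mul_const_of_ne_top (measure_ne_top _ _)).trans (mul_comm _ _)

open Filter in
/-- Two uniformly distributed finite measures are proportional. -/
theorem exists_eq_smul_of_measure_ball_eq {X : Type*} [MetricSpace X] [SecondCountableTopology X]
    [Nonempty X] [MeasurableSpace X] [BorelSpace X] {μ ν : Measure X} [IsFiniteMeasure μ]
    [IsFiniteMeasure ν] {φ ψ : ℝ → ℝ≥0∞} (hμ : ∀ x r, μ (ball x r) = φ r)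
    (hν : ∀ x r, ν (ball x r) = ψ r) (hφ : ∀ r, 0 < r → φ r ≠ 0) (hψ : ∀ r, 0 < r → ψ r ≠ 0) :
    ∃ c : ℝ≥0∞, c ≠ ⊤ ∧ μ = c • ν := by
  obtain ⟨x₀⟩ := ‹Nonempty X›
  have hφt (r) : φ r ≠ ⊤ := by rw [← hμ x₀]; exact measure_ne_top _ _
  have hψt (r) : ψ r ≠ ⊤ := by rw [← hν x₀]; exact measure_ne_top _ _
  set r : ℕ → ℝ := fun k => 1 / ((k : ℝ) + 1) with hr_def
  have hr (k) : 0 < r k := by positivity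
  have hr0 : Tendsto r atTop (nhds 0) := tendsto_one_div_add_atTop_nhds_zero_nat
  set c := liminf (fun k => φ (r k) / ψ (r k)) atTop with hc
  set c' := liminf (fun k => ψ (r k) / φ (r k)) atTop with hc'
  have hcc : c * c' ≤ 1 := by
    refine ENNReal.le_liminf_mul.trans ?_
    have : ((fun k => φ (r k) / ψ (r k)) * fun k => ψ (r k) / φ (r k)) = fun _ => 1 := by
      ext k
      simp only [Pi.mul_apply]
      rw [← ENNReal.mul_div_mul_comm (.inl (hψ _ (hr k))) (.inl (hψt _)), mul_comm (φ _),
        ENNReal.div_self (mul_ne_zero (hψ _ (hr k)) (hφ _ (hr k)))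
          (ENNReal.mul_ne_top (hψt _) (hφt _))]
    rw [this, liminf_const]
  have h1 {U : Set X} (hU : IsOpen U) : μ U ≤ c * ν U :=
    measure_isOpen_le_liminf_mul hμ hν hψ hψt hr hr0 hU
  have h2 {U : Set X} (hU : IsOpen U) : ν U ≤ c' * μ U :=
    measure_isOpen_le_liminf_mul hν hμ hφ hφt hr hr0 hU
  have hc'0 : c' ≠ 0 := by
    intro h0
    have := h2 (isOpen_ball (x := x₀) (ε := 1))
    rw [h0, zero_mul, hν] at this
    exact hψ 1 one_pos (le_antisymm this bot_le)
  have hct : c ≠ ⊤ := by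
    intro h0
    rw [h0, ENNReal.top_mul hc'0] at hcc
    simp at hcc
  have heq (U : Set X) (hU : IsOpen U) : μ U = (c • ν) U := by
    refine le_antisymm (h1 hU) ?_
    calc c * ν U ≤ c * (c' * μ U) := by gcongr; exact h2 hU
      _ = c * c' * μ U := by ring
      _ ≤ 1 * μ U := by gcongr
      _ = μ U := one_mul _
  exact ⟨c, hct, ext_of_generate_finite _ (BorelSpace.measurable_eq (α := X)) isPiSystem_isOpen
    (fun U hU => heq U hU) (heq _ isOpen_univ)⟩

/-- A uniformly distributed measure on a compact space is proportional to a given finite one, as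
far as integrals of continuous functions are concerned; an infinite measure integrates every
continuous function to `0` by convention. -/
theorem exists_integral_eq_smul_of_measure_ball_eq {X : Type*} [MetricSpace X] [CompactSpace X]
    [Nonempty X] [MeasurableSpace X] [BorelSpace X] {μ ν : Measure X}
    [IsFiniteMeasure ν] {φ ψ : ℝ → ℝ≥0∞} (hμ : ∀ x r, μ (ball x r) = φ r)
    (hν : ∀ x r, ν (ball x r) = ψ r) (hψ : ∀ r, 0 < r → ψ r ≠ 0) :
    ∃ c : ℝ, 0 ≤ c ∧ ∀ (F : Type) [NormedAddCommGroup F] [NormedSpace ℝ F] (f : X → F),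
      Continuous f → ∫ x, f x ∂μ = c • ∫ x, f x ∂ν := by
  have cover {r : ℝ} (hr : 0 < r) :
      ∃ t : Finset X, μ Set.univ ≤ t.card * φ r := by
    obtain ⟨t, -, ht⟩ := (isCompact_univ (X := X)).elim_nhds_subcover (fun x => ball x r)
      fun x _ => ball_mem_nhds x hr
    refine ⟨t, (measure_mono ht).trans ((measure_biUnion_finset_le t _).trans ?_)⟩
    simp [hμ]
  by_cases hfin : μ Set.univ = ⊤
  · refine ⟨0, le_rfl, fun F _ _ f hf => ?_⟩
    rw [zero_smul]
    by_cases h0 : ∀ x, f x = 0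
    · simp [h0]
    push Not at h0
    obtain ⟨x, hx⟩ := h0
    refine integral_undef fun hfi => ?_
    obtain ⟨r, hr, hball⟩ := Metric.mem_nhds_iff.1
      ((hf.norm.tendsto x).eventually (lt_mem_nhds (half_lt_self (norm_pos_iff.2 hx))))
    have hlt : φ r < ⊤ := by
      rw [← hμ x]
      refine (measure_mono ?_).trans_lt
        (hfi.measure_norm_ge_lt_top (half_pos (norm_pos_iff.2 hx)))
      exact fun y hy => le_of_lt (α := ℝ) (hball hy)
    obtain ⟨t, ht⟩ := cover hr
    exact (ht.trans_lt (ENNReal.mul_lt_top (ENNReal.natCast_lt_top _) hlt)).ne hfin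
  have : IsFiniteMeasure μ := ⟨lt_top_iff_ne_top.2 hfin⟩
  by_cases hφ : ∀ r, 0 < r → φ r ≠ 0
  · obtain ⟨c, -, rfl⟩ := exists_eq_smul_of_measure_ball_eq hμ hν hφ hψ
    exact ⟨c.toReal, ENNReal.toReal_nonneg, fun F _ _ f _ => integral_smul_measure f c⟩
  · push Not at hφ
    obtain ⟨r, hr, h0⟩ := hφ
    obtain ⟨t, ht⟩ := cover hr
    rw [h0, mul_zero] at ht
    have : μ = 0 := Measure.measure_univ_eq_zero.1 (le_antisymm ht bot_le)
    exact ⟨0, le_rfl, fun F _ _ f _ => by simp [this]⟩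

section
variable {V : Type*} [NormedAddCommGroup V] [InnerProductSpace ℝ V]

theorem exists_linearIsometryEquiv_apply_eq {x y : V} (h : ‖x‖ = ‖y‖) :
    ∃ e : V ≃ₗᵢ[ℝ] V, e x = y :=
  ⟨(Submodule.span ℝ {x - y})ᗮ.reflection, Submodule.reflection_sub h⟩

/-- The isometry of the unit sphere induced by a linear isometry. -/
def LinearIsometryEquiv.sphereIsometry (e : V ≃ₗᵢ[ℝ] V) : sphere (0 : V) 1 ≃ᵢ sphere (0 : V) 1 where
  toFun x := ⟨e x, by simp⟩
  invFun x := ⟨e.symm x, by simp⟩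
  left_inv x := by simp
  right_inv x := by simp
  isometry_toFun x y := by simp [Subtype.edist_eq]

variable [MeasurableSpace V] [BorelSpace V]

theorem measure_sphere_ball_eq {μ : Measure (sphere (0 : V) 1)}
    (hμ : ∀ e : V ≃ₗᵢ[ℝ] V, μ.map e.sphereIsometry = μ) (x y : sphere (0 : V) 1) (r : ℝ) :
    μ (ball x r) = μ (ball y r) := by
  obtain ⟨e, he⟩ := exists_linearIsometryEquiv_apply_eq (x := (x : V)) (y := y) (by simp)
  have hxy : e.sphereIsometry x = y := Subtype.ext he
  rw [← hxy]
  conv_rhs => rw [← hμ e]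
  rw [Measure.map_apply e.sphereIsometry.continuous.measurable measurableSet_ball,
    e.sphereIsometry.preimage_ball, IsometryEquiv.symm_apply_apply]

variable [FiniteDimensional ℝ V]

open scoped Pointwise in
theorem map_toSphere_sphereIsometry (e : V ≃ₗᵢ[ℝ] V) :
    (volume : Measure V).toSphere.map e.sphereIsometry = (volume : Measure V).toSphere := by
  ext s hs
  have hm := e.sphereIsometry.continuous.measurable
  rw [Measure.map_apply hm hs, Measure.toSphere_apply' _ hs, Measure.toSphere_apply' _ (hm hs)]
  congr 1
  have : Set.Ioo (0 : ℝ) 1 • (Subtype.val '' (e.sphereIsometry ⁻¹' s)) =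
      e ⁻¹' (Set.Ioo (0 : ℝ) 1 • (Subtype.val '' s)) := by
    ext z
    simp only [Set.mem_smul, Set.mem_image, Set.mem_preimage]
    constructor
    · rintro ⟨t, ht, -, ⟨x, hx, rfl⟩, rfl⟩
      exact ⟨t, ht, _, ⟨_, hx, rfl⟩, (map_smul e t (x : V)).symm⟩
    · rintro ⟨t, ht, -, ⟨x, hx, rfl⟩, hz⟩
      refine ⟨t, ht, _, ⟨e.sphereIsometry.symm x, by simpa using hx, rfl⟩, ?_⟩
      apply e.injective
      rw [← hz, map_smul]
      congr 1
      exact congrArg Subtype.val (e.sphereIsometry.apply_symm_apply x)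
  rw [this]
  exact e.measurePreserving.measure_preimage_equiv (f := e.toMeasurableEquiv) _

/-- The Hausdorff measure on the unit sphere is proportional to the surface measure. -/
theorem exists_setIntegral_sphere_eq [Nontrivial V] (d : ℝ) (hd : 0 ≤ d) :
    ∃ c : ℝ, 0 ≤ c ∧ ∀ (F : Type) [NormedAddCommGroup F] [NormedSpace ℝ F] (f : V → F),
      ContinuousOn f (sphere 0 1) → ∫ x in sphere (0 : V) 1, f x ∂μH[d] =
        c • ∫ x : sphere (0 : V) 1, f x ∂(volume : Measure V).toSphere := by
  have : Nonempty (sphere (0 : V) 1) := (NormedSpace.sphere_nonempty.2 zero_le_one).to_subtype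
  have x₀ : sphere (0 : V) 1 := Classical.arbitrary _
  have hH (e : V ≃ₗᵢ[ℝ] V) : (μH[d] : Measure (sphere (0 : V) 1)).map e.sphereIsometry = μH[d] :=
    e.sphereIsometry.map_hausdorffMeasure d
  obtain ⟨c, hc, H⟩ := exists_integral_eq_smul_of_measure_ball_eq
    (μ := (μH[d] : Measure (sphere (0 : V) 1))) (ν := (volume : Measure V).toSphere)
    (fun x r => measure_sphere_ball_eq hH x x₀ r)
    (fun x r => measure_sphere_ball_eq map_toSphere_sphereIsometry x x₀ r)
    (fun r hr => (isOpen_ball.measure_pos _ ⟨x₀, mem_ball_self hr⟩).ne')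
  refine ⟨c, hc, fun F _ _ f hf => ?_⟩
  rw [← H F (fun x : sphere (0 : V) 1 => f x) (continuousOn_iff_continuous_domRestrict.1 hf)]
  have hmap := (isometry_subtype_coe (s := sphere (0 : V) 1)).map_hausdorffMeasure (.inl hd)
  rw [Subtype.range_coe] at hmap
  rw [← hmap, (MeasurableEmbedding.subtype_coe isClosed_sphere.measurableSet).integral_map]

end

/-- `H` is a smooth positive 1-homogeneous function whose restriction to the sphere is the support
function of a strictly convex body with the origin in its interior. -/
structure IsSupport {n : ℕ} (H : E n → ℝ) : Prop where
  hom : ∀ (t : ℝ) (x : E n), 0 < t → H (t • x) = t * H x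
  smooth : ContDiffOn ℝ (⊤ : ℕ∞) H {(0 : E n)}ᶜ
  pos_sphere : ∀ x ∈ sphere (0 : E n) 1, 0 < H x
  convex : ∀ x ∈ sphere (0 : E n) 1, ∀ v : E n, ⟪v, x⟫ = 0 → v ≠ 0 → 0 < ⟪(hess H x) v, v⟫

theorem inv_norm_smul_mem_sphere {V : Type*} [NormedAddCommGroup V] [NormedSpace ℝ V] {x : V}
    (hx : x ≠ 0) : ‖x‖⁻¹ • x ∈ sphere (0 : V) 1 := by
  simp [norm_smul, hx]

theorem norm_smul_inv_norm_smul {V : Type*} [NormedAddCommGroup V] [NormedSpace ℝ V] {x : V}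
    (hx : x ≠ 0) : ‖x‖ • (‖x‖⁻¹ • x) = x := by
  rw [smul_smul, mul_inv_cancel₀ (norm_ne_zero_iff.2 hx), one_smul]

namespace IsSupport
variable {n : ℕ} {H : E n → ℝ} (hH : IsSupport H)
include hH

theorem map_zero : H 0 = 0 := by
  have := hH.hom 2 0 two_pos
  rw [smul_zero] at this
  linarith

theorem eq_norm_mul {x : E n} (hx : x ≠ 0) : H x = ‖x‖ * H (‖x‖⁻¹ • x) := by
  rw [← hH.hom _ _ (norm_pos_iff.2 hx), norm_smul_inv_norm_smul hx]

theorem pos {x : E n} (hx : x ≠ 0) : 0 < H x := by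
  rw [hH.eq_norm_mul hx]
  exact mul_pos (norm_pos_iff.2 hx) (hH.pos_sphere _ (inv_norm_smul_mem_sphere hx))

theorem nonneg (x : E n) : 0 ≤ H x := by
  rcases eq_or_ne x 0 with rfl | hx
  · exact hH.map_zero.ge
  · exact (hH.pos hx).le

theorem contDiffAt {x : E n} (hx : x ≠ 0) : ContDiffAt ℝ (⊤ : ℕ∞) H x :=
  hH.smooth.contDiffAt (isOpen_compl_singleton.mem_nhds hx)

theorem hasGradientAt {x : E n} (hx : x ≠ 0) : HasGradientAt H (gradient H x) x :=
  ((hH.contDiffAt hx).differentiableAt (by simp)).hasGradientAt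

theorem contDiffAt_gradient {x : E n} (hx : x ≠ 0) : ContDiffAt ℝ (⊤ : ℕ∞) (gradient H) x := by
  have := (hH.contDiffAt hx).fderiv_right (m := (⊤ : ℕ∞)) (by simp)
  exact (InnerProductSpace.toDual ℝ (E n)).symm.contDiff.contDiffAt.comp x this

theorem hasFDerivAt_gradient {x : E n} (hx : x ≠ 0) :
    HasFDerivAt (gradient H) (hess H x) x :=
  ((hH.contDiffAt_gradient hx).differentiableAt (by simp)).hasFDerivAt

theorem contDiffAt_hess {x : E n} (hx : x ≠ 0) : ContDiffAt ℝ (⊤ : ℕ∞) (hess H) x :=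
  (hH.contDiffAt_gradient hx).fderiv_right (by simp)

theorem hasDerivAt_comp {c : ℝ → E n} {c' : E n} {t : ℝ} (hc : HasDerivAt c c' t) (h0 : c t ≠ 0) :
    HasDerivAt (fun s => H (c s)) ⟪gradient H (c t), c'⟫ t := by
  exact (hH.hasGradientAt h0).hasFDerivAt.comp_hasDerivAt t hc

theorem gradient_smul {t : ℝ} (ht : 0 < t) {x : E n} (hx : x ≠ 0) :
    gradient H (t • x) = gradient H x := by
  have h1 : HasFDerivAt (fun y => H (t • y)) _ x :=
    (hH.hasGradientAt (smul_ne_zero ht.ne' hx)).hasFDerivAt.comp x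
      ((hasFDerivAt_id x).const_smul t)
  have h2 : HasFDerivAt (fun y => H (t • y)) _ x :=
    ((hH.hasGradientAt hx).hasFDerivAt.const_mul t).congr_of_eventuallyEq
      (.of_forall fun y => hH.hom t y ht)
  refine ext_inner_right ℝ fun v => ?_
  have := congrArg (fun L => L v) (h1.unique h2)
  simpa [inner_gradient_left, ht.ne'] using this

theorem inner_gradient_self {x : E n} (hx : x ≠ 0) : ⟪gradient H x, x⟫ = H x := by
  have h1 : HasDerivAt (fun s : ℝ => H (s • x)) _ 1 :=
    hH.hasDerivAt_comp ((hasDerivAt_id (1 : ℝ)).smul_const x) (by simpa using hx)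
  have h2 : HasDerivAt (fun s : ℝ => H (s • x)) (1 * H x) 1 :=
    ((hasDerivAt_id (1 : ℝ)).mul_const (H x)).congr_of_eventuallyEq
      ((lt_mem_nhds one_pos).mono fun s hs => hH.hom s x hs)
  simpa using h1.unique h2

theorem hess_smul {t : ℝ} (ht : 0 < t) {x : E n} (hx : x ≠ 0) :
    t • hess H (t • x) = hess H x := by
  have h1 : HasFDerivAt (fun y => gradient H (t • y)) _ x :=
    (hH.hasFDerivAt_gradient (smul_ne_zero ht.ne' hx)).comp x ((hasFDerivAt_id x).const_smul t)
  have h2 : HasFDerivAt (fun y => gradient H (t • y)) (hess H x) x :=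
    (hH.hasFDerivAt_gradient hx).congr_of_eventuallyEq
      (Filter.mem_of_superset (isOpen_compl_singleton.mem_nhds hx)
        fun y hy => hH.gradient_smul ht hy)
  rw [← h1.unique h2]
  ext v
  simp

theorem hess_apply_self {x : E n} (hx : x ≠ 0) : hess H x x = 0 := by
  have h1 : HasDerivAt (fun s : ℝ => gradient H (s • x)) (hess H ((1 : ℝ) • x) ((1 : ℝ) • x)) 1 :=
    (hH.hasFDerivAt_gradient (by simpa using hx)).comp_hasDerivAt 1
      ((hasDerivAt_id (1 : ℝ)).smul_const x)
  have h2 : HasDerivAt (fun s : ℝ => gradient H (s • x)) 0 1 :=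
    (hasDerivAt_const (1 : ℝ) (gradient H x)).congr_of_eventuallyEq
      ((lt_mem_nhds one_pos).mono fun s hs => hH.gradient_smul hs hx)
  simpa using h1.unique h2

theorem inner_hess_self {x : E n} (hx : x ≠ 0) (v : E n) : ⟪hess H x v, x⟫ = 0 := by
  have h1 := (hH.hasFDerivAt_gradient hx).inner ℝ (hasFDerivAt_id x)
  have h2 : HasFDerivAt (fun y => ⟪gradient H y, id y⟫) _ x :=
    (hH.hasGradientAt hx).hasFDerivAt.congr_of_eventuallyEq
      (Filter.mem_of_superset (isOpen_compl_singleton.mem_nhds hx)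
        fun y hy => hH.inner_gradient_self hy)
  have := congrArg (fun L => L v) (h1.unique h2)
  simpa using this

theorem inner_hess_pos {x : E n} (hx : x ≠ 0) {v : E n} (hv : ∀ a : ℝ, v ≠ a • x) :
    0 < ⟪hess H x v, v⟫ := by
  set u := ‖x‖⁻¹ • x with hu
  have hus : u ∈ sphere (0 : E n) 1 := inv_norm_smul_mem_sphere hx
  have hu1 : ‖u‖ = 1 := by simpa using hus
  have hu0 : u ≠ 0 := by rintro h; simp [h] at hu1
  set w := v - ⟪v, u⟫ • u with hw
  have hwu : ⟪w, u⟫ = 0 := by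
    simp [hw, inner_sub_left, inner_smul_left, hu1]
  have hw0 : w ≠ 0 := by
    intro h
    refine hv (⟪v, u⟫ * ‖x‖⁻¹) ?_
    rw [mul_smul, ← hu]
    exact sub_eq_zero.1 h
  have h1 := hH.convex u hus w hwu hw0
  have h2 : hess H u v = hess H u w := by
    rw [hw, map_sub, map_smul, hH.hess_apply_self hu0]; simp
  have h3 : ⟪hess H u w, w⟫ = ⟪hess H u v, v⟫ := by
    rw [← h2, hw, inner_sub_right, inner_smul_right, hH.inner_hess_self hu0, mul_zero, sub_zero]
  have h4 : hess H x = ‖x‖⁻¹ • hess H u := by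
    rw [hu, hH.hess_smul (inv_pos.2 (norm_pos_iff.2 hx)) hx]
  rw [h4]
  simp only [smul_apply, inner_smul_left]
  rw [← h3]
  exact mul_pos (by simpa using hx) h1

theorem inner_gradient_lt {x z : E n} (hx : x ≠ 0) (hz : ∀ a : ℝ, z ≠ a • x) :
    ⟪gradient H x, z⟫ < H z := by
  set c : ℝ → E n := fun s => x + s • (z - x) with hc
  have hmul (s a : ℝ) : z - x ≠ a • c s := by
    intro h
    have h1 : (1 - a * s) • z = (1 + a - a * s) • x := by
      have h2 : (1 - a * s) • z - (1 + a - a * s) • x = (z - x) - a • c s := by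
        simp only [hc]; module
      rwa [h, sub_self, sub_eq_zero] at h2
    rcases eq_or_ne (1 - a * s) 0 with h0 | h0
    · rw [h0, zero_smul] at h1
      have h2 : 1 + a - a * s = 0 := by simpa [hx] using h1.symm
      have : a = 0 := by linarith
      simp [this] at h0
    · refine hz ((1 - a * s)⁻¹ * (1 + a - a * s)) ?_
      rw [mul_smul, ← h1, smul_smul, inv_mul_cancel₀ h0, one_smul]
  have hc0 (s : ℝ) : c s ≠ 0 := by
    intro h
    rcases eq_or_ne s 0 with rfl | hs
    · exact hx (by simpa [hc] using h)
    · refine hz (s⁻¹ * (s - 1)) ?_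
      have h1 : s • z = (s - 1) • x := by
        have h2 : s • z - (s - 1) • x = c s := by
          simp only [hc]; module
        rwa [h, sub_eq_zero] at h2
      rw [mul_smul, ← h1, smul_smul, inv_mul_cancel₀ hs, one_smul]
  have hcd (s : ℝ) : HasDerivAt c (z - x) s := by
    have := ((hasDerivAt_id s).smul_const (z - x)).const_add x
    rwa [one_smul] at this
  have hφ (s : ℝ) : HasDerivAt (fun s => H (c s)) ⟪gradient H (c s), z - x⟫ s :=
    hH.hasDerivAt_comp (hcd s) (hc0 s)
  have hφ' (s : ℝ) : HasDerivAt (fun s => ⟪gradient H (c s), z - x⟫)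
      ⟪hess H (c s) (z - x), z - x⟫ s := by
    have h1 := (hH.hasFDerivAt_gradient (hc0 s)).comp_hasDerivAt s (hcd s)
    simpa only [inner_zero_right, zero_add] using! h1.inner ℝ (hasDerivAt_const s (z - x))
  have hmono : StrictMono fun s => ⟪gradient H (c s), z - x⟫ :=
    strictMono_of_deriv_pos fun s => by
      rw [(hφ' s).deriv]
      exact hH.inner_hess_pos (hc0 s) (hmul s)
  obtain ⟨s, hs, h⟩ := exists_hasDerivAt_eq_slope (fun s => H (c s)) _ zero_lt_one
    (fun s _ => (hφ s).continuousAt.continuousWithinAt) (fun s _ => hφ s)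
  have h1 := hmono hs.1
  simp only [h] at h1
  have e0 : c 0 = x := by simp [hc]
  have e1 : c 1 = z := by simp [hc]
  rw [e0, e1, inner_sub_right, hH.inner_gradient_self hx] at h1
  linarith

theorem inner_gradient_le {x : E n} (hx : x ≠ 0) (z : E n) : ⟪gradient H x, z⟫ ≤ H z := by
  by_cases hz : ∀ a : ℝ, z ≠ a • x
  · exact (hH.inner_gradient_lt hx hz).le
  push Not at hz
  obtain ⟨a, rfl⟩ := hz
  rw [inner_smul_right, hH.inner_gradient_self hx]
  rcases lt_or_ge 0 a with ha | ha
  · exact (hH.hom a x ha).ge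
  · exact (mul_nonpos_of_nonpos_of_nonneg ha (hH.nonneg x)).trans (hH.nonneg _)

theorem eq_smul_of_inner_gradient_eq {x z : E n} (hx : x ≠ 0) (hz : z ≠ 0)
    (h : ⟪gradient H x, z⟫ = H z) : ∃ t : ℝ, z = t • x ∧ 0 < t := by
  by_contra! h'
  by_cases hz' : ∀ a : ℝ, z ≠ a • x
  · exact (hH.inner_gradient_lt hx hz').ne h
  push Not at hz'
  obtain ⟨a, rfl⟩ := hz'
  have ha := h' a rfl
  rw [inner_smul_right, hH.inner_gradient_self hx] at h
  have := hH.pos hz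
  nlinarith [hH.nonneg x]

theorem exists_bounds : ∃ a b : ℝ, 0 < a ∧ 0 < b ∧ ∀ x : E n, a * ‖x‖ ≤ H x ∧ H x ≤ b * ‖x‖ := by
  have hcont : ContinuousOn H (sphere (0 : E n) 1) := fun x hx =>
    (hH.contDiffAt (ne_zero_of_mem_unit_sphere ⟨x, hx⟩)).continuousAt.continuousWithinAt
  have hne : (sphere (0 : E n) 1).Nonempty := NormedSpace.sphere_nonempty.2 zero_le_one
  obtain ⟨u, hu, hmin⟩ := (isCompact_sphere (0 : E n) 1).exists_isMinOn hne hcont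
  obtain ⟨v, hv, hmax⟩ := (isCompact_sphere (0 : E n) 1).exists_isMaxOn hne hcont
  refine ⟨H u, H v, hH.pos_sphere u hu, hH.pos_sphere v hv, fun x => ?_⟩
  rcases eq_or_ne x 0 with rfl | hx
  · simp [hH.map_zero]
  have hs := inv_norm_smul_mem_sphere hx
  rw [hH.eq_norm_mul hx, mul_comm, mul_comm _ ‖x‖]
  exact ⟨mul_le_mul_of_nonneg_left (hmin hs) (norm_nonneg _),
    mul_le_mul_of_nonneg_left (hmax hs) (norm_nonneg _)⟩

theorem continuous : Continuous H := by
  refine continuous_iff_continuousAt.2 fun x => ?_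
  rcases eq_or_ne x 0 with rfl | hx
  · obtain ⟨a, b, -, -, h⟩ := hH.exists_bounds
    rw [ContinuousAt, hH.map_zero]
    refine squeeze_zero (fun x => hH.nonneg x) (fun x => (h x).2) ?_
    have : Continuous fun x : E n => b * ‖x‖ := by fun_prop
    simpa using this.tendsto 0
  · exact (hH.contDiffAt hx).continuousAt

theorem hasFDerivAt_smul_gradient {x : E n} (hx : x ≠ 0) :
    HasFDerivAt (fun x => H x • gradient H x) (H x • hess H x + proj (gradient H x)) x := by
  have := (hH.hasGradientAt hx).hasFDerivAt.smul (hH.hasFDerivAt_gradient hx)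
  convert! this using 1

theorem smul_gradient_ne_zero {x : E n} (hx : x ≠ 0) : H x • gradient H x ≠ 0 := by
  refine smul_ne_zero (hH.pos hx).ne' fun h => (hH.pos hx).ne' ?_
  rw [← hH.inner_gradient_self hx, h, inner_zero_left]

theorem injOn_smul_gradient : Set.InjOn (fun x => H x • gradient H x) {(0 : E n)}ᶜ := by
  have key : ∀ x y : E n, x ≠ 0 → y ≠ 0 → H x • gradient H x = H y • gradient H y → H y ≤ H x := by
    intro x y hx hy h
    have h1 : H x * ⟪gradient H x, y⟫ = H y * H y := by
      rw [← real_inner_smul_left, h, real_inner_smul_left, hH.inner_gradient_self hy]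
    nlinarith [hH.pos hx, hH.pos hy, hH.inner_gradient_le hx y]
  intro x hx y hy h
  replace h : H x • gradient H x = H y • gradient H y := h
  have hxy : H x = H y := le_antisymm (key y x hy hx h.symm) (key x y hx hy h)
  rw [hxy] at h
  have h2 := smul_right_injective (E n) (hH.pos hy).ne' h
  obtain ⟨t, rfl, ht⟩ := hH.eq_smul_of_inner_gradient_eq (x := x) (z := y) hx hy
    (by rw [show gradient H x = gradient H y from h2, hH.inner_gradient_self hy])
  rw [hH.hom t x ht] at hxy
  have : t = 1 := by nlinarith [hH.pos hx]
  simp [this]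

theorem exists_dual : ∃ N : E n → ℝ, Continuous N ∧ (∀ y x, ⟪y, x⟫ ≤ N y * H x) ∧
    (∀ x, x ≠ 0 → N (H x • gradient H x) = H x) ∧
    ∀ y, ∃ u ∈ sphere (0 : E n) 1, ⟪y, u⟫ = N y * H u := by
  set q : E n → sphere (0 : E n) 1 → ℝ := fun y u => ⟪y, u⟫ / H u with hq
  have hu (u : sphere (0 : E n) 1) : 0 < H u := hH.pos_sphere u u.2
  have hqc : Continuous (Function.uncurry q) := by
    have : Continuous fun p : E n × sphere (0 : E n) 1 => ⟪p.1, (p.2 : E n)⟫ / H p.2 :=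
      Continuous.div (by fun_prop) (hH.continuous.comp (by fun_prop)) fun p => (hu p.2).ne'
    exact this
  have hK : IsCompact (Set.univ : Set (sphere (0 : E n) 1)) := isCompact_univ
  have hne : (Set.univ : Set (sphere (0 : E n) 1)).Nonempty :=
    Set.nonempty_iff_univ_nonempty.1
      (NormedSpace.sphere_nonempty.2 zero_le_one).to_subtype
  have hatt (y : E n) : ∃ u : sphere (0 : E n) 1, sSup (q y '' Set.univ) = q y u ∧
      ∀ v, q y v ≤ q y u := by
    obtain ⟨u, -, h, h'⟩ := hK.exists_sSup_image_eq_and_ge hne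
      (show ContinuousOn (q y) Set.univ from (hqc.comp (.prodMk_right y)).continuousOn)
    exact ⟨u, h, fun v => h' v trivial⟩
  have hle (y x : E n) : ⟪y, x⟫ ≤ sSup (q y '' Set.univ) * H x := by
    rcases eq_or_ne x 0 with rfl | hx
    · simp [hH.map_zero]
    obtain ⟨u, h, h'⟩ := hatt y
    have h1 := h' ⟨_, inv_norm_smul_mem_sphere hx⟩
    have h2 := hH.pos_sphere _ (inv_norm_smul_mem_sphere hx)
    rw [hH.eq_norm_mul hx, h]
    nth_rewrite 1 [← norm_smul_inv_norm_smul hx]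
    rw [real_inner_smul_right]
    rw [hq] at h1
    simp only [div_le_iff₀ h2] at h1
    have := mul_le_mul_of_nonneg_left h1 (norm_nonneg x)
    linarith
  refine ⟨fun y => sSup (q y '' Set.univ), hK.continuous_sSup hqc, hle, fun x hx => ?_, fun y => ?_⟩
  · refine le_antisymm ?_ ?_
    · obtain ⟨u, h, -⟩ := hatt (H x • gradient H x)
      change sSup (q (H x • gradient H x) '' Set.univ) ≤ _
      rw [h, hq]
      simp only [div_le_iff₀ (hu u), real_inner_smul_left]
      exact mul_le_mul_of_nonneg_left (hH.inner_gradient_le hx _) (hH.nonneg x)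
    · have := hle (H x • gradient H x) x
      rw [real_inner_smul_left, hH.inner_gradient_self hx] at this
      exact le_of_mul_le_mul_right this (hH.pos hx)
  · obtain ⟨u, h, -⟩ := hatt y
    refine ⟨u, u.2, ?_⟩
    change _ = sSup (q y '' Set.univ) * _
    rw [h, hq]
    exact (div_mul_cancel₀ _ (hu u).ne').symm

theorem image_smul_gradient : (fun x => H x • gradient H x) '' {(0 : E n)}ᶜ = {0}ᶜ := by
  refine Set.Subset.antisymm ?_ fun y hy => ?_
  · rintro _ ⟨x, hx, rfl⟩
    exact hH.smul_gradient_ne_zero hx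
  obtain ⟨N, -, hN, -, hatt⟩ := hH.exists_dual
  obtain ⟨u, hu, he⟩ := hatt y
  have hu0 : u ≠ 0 := ne_zero_of_mem_unit_sphere ⟨u, hu⟩
  have hm : 0 < N y := by
    have h1 := hN y y
    have h2 : 0 < ⟪y, y⟫ := real_inner_self_pos.2 hy
    exact pos_of_mul_pos_left (h2.trans_le h1) (hH.nonneg y)
  have hmax : IsLocalMax (fun x => ⟪y, x⟫ - N y * H x) u := .of_forall fun x => by
    simp only [he, sub_self]
    linarith [hN y x]
  have hd : HasFDerivAt (fun x => ⟪y, x⟫ - N y * H x)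
      (innerSL ℝ y - N y • (InnerProductSpace.toDual ℝ (E n)) (gradient H u)) u :=
    (innerSL ℝ y).hasFDerivAt.sub ((hH.hasGradientAt hu0).hasFDerivAt.const_mul _)
  have h0 := hmax.hasFDerivAt_eq_zero hd
  have hy' : y = N y • gradient H u := by
    refine ext_inner_right ℝ fun v => ?_
    have := congrArg (fun L => L v) h0
    simp only [sub_apply, smul_apply, innerSL_apply_apply, InnerProductSpace.toDual_apply_apply,
      smul_eq_mul, zero_apply] at this
    rw [real_inner_smul_left]
    linarith
  have ht : 0 < N y / H u := div_pos hm (hH.pos hu0)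
  refine ⟨(N y / H u) • u, smul_ne_zero ht.ne' hu0, ?_⟩
  simp only
  rw [hH.gradient_smul ht hu0, hH.hom _ _ ht, div_mul_cancel₀ _ (hH.pos hu0).ne', ← hy']

end IsSupport

theorem proj_apply {n : ℕ} (x v : E n) : proj x v = ⟪x, v⟫ • x := rfl

theorem det_smul_add_proj {n : ℕ} (A : E n →L[ℝ] E n) {u : E n} (hu : ‖u‖ = 1)
    (hA : A u = 0) (hA' : ∀ v, ⟪u, A v⟫ = 0) (y : E n) {c : ℝ} (hc : c ≠ 0) :
    LinearMap.det (c • A + proj y).toLinearMap =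
      ⟪u, y⟫ ^ 2 * (c ^ n * LinearMap.det (A + proj u).toLinearMap) := by
  have huu : ⟪u, u⟫ = 1 := by rw [real_inner_self_eq_norm_sq, hu, one_pow]
  have h1 : (c • A + proj y).toLinearMap =
      LinearMap.transvection (innerSL ℝ u).toLinearMap (y - u) ∘ₗ (c • A + proj u).toLinearMap ∘ₗ
        LinearMap.transvection (innerSL ℝ (y - u)).toLinearMap u := by
    ext1 v
    simp only [LinearMap.comp_apply, LinearMap.transvection.apply, ContinuousLinearMap.coe_coe,
      add_apply, smul_apply, proj_apply, map_add, map_smul, hA, innerSL_apply_apply, huu,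
      inner_zero_right, hA', inner_sub_left]
    module
  have h2 : (c • A + proj u).toLinearMap = (A + proj u).toLinearMap ∘ₗ
      (c • LinearMap.transvection (innerSL ℝ u).toLinearMap ((c⁻¹ * (1 - c)) • u)) := by
    ext1 v
    simp only [LinearMap.comp_apply, LinearMap.transvection.apply, ContinuousLinearMap.coe_coe,
      add_apply, smul_apply, LinearMap.smul_apply, proj_apply, map_add, map_smul, hA,
      innerSL_apply_apply, huu]
    match_scalars
    · ring
    · field_simp
      ring
  rw [h1, LinearMap.det_comp, LinearMap.det_comp, h2, LinearMap.det_comp, LinearMap.det_smul,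
    LinearMap.transvection.det, LinearMap.transvection.det, LinearMap.transvection.det]
  simp only [ContinuousLinearMap.coe_coe, innerSL_apply_apply, inner_sub_right, inner_sub_left,
    inner_smul_right, huu, finrank_euclideanSpace, Fintype.card_fin, real_inner_comm u y]
  field_simp
  ring

theorem det_pos_of_inner_pos {n : ℕ} {T : E n →L[ℝ] E n}
    (hT : ∀ v, v ≠ 0 → 0 < ⟪T v, v⟫) : 0 < LinearMap.det T.toLinearMap := by
  set φ : ℝ → ℝ := fun t => ((1 - t) • ContinuousLinearMap.id ℝ (E n) + t • T).det with hφ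
  have hcont : Continuous φ := ContinuousLinearMap.continuous_det.comp (by fun_prop)
  have hne : ∀ t ∈ Set.Icc (0 : ℝ) 1, φ t ≠ 0 := by
    intro t ht h0
    obtain ⟨v, hv, hv0⟩ :=
      (Submodule.ne_bot_iff _).1 (LinearMap.bot_lt_ker_of_det_eq_zero h0).ne'
    have h1 : (1 - t) • v + t • T v = 0 := hv
    have h2 : (1 - t) * ⟪v, v⟫ + t * ⟪T v, v⟫ = 0 := by
      rw [← real_inner_smul_left, ← real_inner_smul_left, ← inner_add_left, h1, inner_zero_left]
    have h3 := hT v hv0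
    have h4 : 0 < ⟪v, v⟫ := real_inner_self_pos.2 hv0
    rcases ht.1.eq_or_lt with rfl | h5
    · simp at h2
      exact hv0 h2
    · nlinarith [ht.2, mul_pos h5 h3, mul_nonneg (sub_nonneg.2 ht.2) h4.le]
  have h0 : φ 0 = 1 := by simp [hφ, ContinuousLinearMap.det]
  have h1 : φ 1 = LinearMap.det T.toLinearMap := by simp [hφ, ContinuousLinearMap.det]
  rw [← h1]
  by_contra! hle
  obtain ⟨t, ht, h⟩ := intermediate_value_Icc' zero_le_one hcont.continuousOn
    (show (0 : ℝ) ∈ Set.Icc (φ 1) (φ 0) from ⟨hle, by rw [h0]; exact zero_le_one⟩)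
  exact hne t ht h

/-- The Jacobian determinant of `D(H²/2) = H • DH`. -/
def jacobian {n : ℕ} (H : E n → ℝ) (x : E n) : ℝ :=
  LinearMap.det ((H x • hess H x + proj (gradient H x)) : E n →L[ℝ] E n).toLinearMap

namespace IsSupport
variable {n : ℕ} {H : E n → ℝ} (hH : IsSupport H)
include hH

theorem jacobian_smul {t : ℝ} (ht : 0 < t) {x : E n} (hx : x ≠ 0) :
    jacobian H (t • x) = jacobian H x := by
  rw [jacobian, jacobian, hH.gradient_smul ht hx, hH.hom t x ht, mul_comm, mul_smul,
    hH.hess_smul ht hx]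

theorem jacobian_eq {u : E n} (hu : u ∈ sphere (0 : E n) 1) :
    jacobian H u = H u ^ (n + 2) * sigmaDet H u := by
  have hu0 : u ≠ 0 := ne_zero_of_mem_unit_sphere ⟨u, hu⟩
  rw [jacobian, det_smul_add_proj (hess H u) (by simpa using hu) (hH.hess_apply_self hu0)
    (fun v => by rw [real_inner_comm, hH.inner_hess_self hu0]) _ (hH.pos hu0).ne', real_inner_comm,
    hH.inner_gradient_self hu0, sigmaDet]
  ring

theorem sigmaDet_pos {u : E n} (hu : u ∈ sphere (0 : E n) 1) : 0 < sigmaDet H u := by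
  have hu0 : u ≠ 0 := ne_zero_of_mem_unit_sphere ⟨u, hu⟩
  refine det_pos_of_inner_pos fun v hv => ?_
  simp only [add_apply, proj_apply, inner_add_left, real_inner_smul_left]
  by_cases h : ∀ a : ℝ, v ≠ a • u
  · nlinarith [hH.inner_hess_pos hu0 h, mul_self_nonneg ⟪u, v⟫]
  push Not at h
  obtain ⟨a, rfl⟩ := h
  have h1 : ⟪u, u⟫ = 1 := by rw [real_inner_self_eq_norm_sq]; simp [mem_sphere_zero_iff_norm.1 hu]
  have h2 : a ≠ 0 := by rintro rfl; simp at hv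
  rw [map_smul, hH.hess_apply_self hu0, smul_zero, inner_zero_left, zero_add,
    real_inner_smul_right, h1, mul_one]
  exact mul_self_pos.2 h2

theorem jacobian_pos {x : E n} (hx : x ≠ 0) : 0 < jacobian H x := by
  have hs := inv_norm_smul_mem_sphere hx
  rw [← norm_smul_inv_norm_smul hx,
    hH.jacobian_smul (norm_pos_iff.2 hx) (ne_zero_of_mem_unit_sphere ⟨_, hs⟩), hH.jacobian_eq hs]
  exact mul_pos (pow_pos (hH.pos_sphere _ hs) _) (hH.sigmaDet_pos hs)

theorem continuousAt_jacobian {x : E n} (hx : x ≠ 0) : ContinuousAt (jacobian H) x := by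
  refine ContinuousLinearMap.continuous_det.continuousAt.comp (f := fun x =>
    (H x • hess H x + proj (gradient H x) : E n →L[ℝ] E n)) ?_
  have h1 := hH.continuous.continuousAt (x := x)
  have h2 := (hH.contDiffAt_hess hx).continuousAt
  have h3 := (hH.contDiffAt_gradient hx).continuousAt
  refine (h1.smul h2).add ?_
  have : Continuous fun y : E n => proj y := by
    unfold proj
    exact ((ContinuousLinearMap.smulRightL ℝ (E n) (E n)).continuous₂).comp
      ((innerSL ℝ).continuous.prodMk continuous_id)
  exact this.continuousAt.comp h3

theorem lintegral_eq_lintegral_jacobian_mul (g : E n → ℝ≥0∞) :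
    ∫⁻ y, g y = ∫⁻ x, ENNReal.ofReal (jacobian H x) * g (H x • gradient H x) := by
  have hae : ({(0 : E n)}ᶜ : Set (E n)) =ᵐ[volume] Set.univ := by
    rw [ae_eq_univ, compl_compl]
    exact measure_singleton _
  have := lintegral_image_eq_lintegral_abs_det_fderiv_mul volume
    (measurableSet_singleton (0 : E n)).compl
    (fun x hx => (hH.hasFDerivAt_smul_gradient hx).hasFDerivWithinAt) hH.injOn_smul_gradient g
  rw [hH.image_smul_gradient] at this
  rw [← setLIntegral_univ, ← setLIntegral_congr hae, this]
  rw [← setLIntegral_univ (fun x => ENNReal.ofReal (jacobian H x) * _), ← setLIntegral_congr hae]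
  refine setLIntegral_congr_fun (measurableSet_singleton (0 : E n)).compl fun x hx => ?_
  have : (H x • hess H x + proj (gradient H x) : E n →L[ℝ] E n).det = jacobian H x := rfl
  simp only [this, abs_of_pos (hH.jacobian_pos hx)]

end IsSupport

theorem integral_eq_integral_toSphere {V : Type*} [NormedAddCommGroup V] [NormedSpace ℝ V]
    [MeasurableSpace V] [Nontrivial V] (μ : Measure V) [FiniteDimensional ℝ V] [BorelSpace V]
    [μ.IsAddHaarMeasure] {f : V → ℝ} (hf : Integrable f μ) :
    ∫ x, f x ∂μ = ∫ u : sphere (0 : V) 1, ∫ r in Set.Ioi (0 : ℝ),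
      r ^ (Module.finrank ℝ V - 1) * f (r • (u : V)) ∂volume ∂μ.toSphere := by
  set g : sphere (0 : V) 1 × Set.Ioi (0 : ℝ) → ℝ := fun p => f ((p.2 : ℝ) • (p.1 : V)) with hg
  have hcomp : (fun x : ({0}ᶜ : Set V) => f x) = g ∘ homeomorphUnitSphereProd V := by
    ext x
    have : f ((homeomorphUnitSphereProd V).symm (homeomorphUnitSphereProd V x)) =
      g (homeomorphUnitSphereProd V x) := rfl
    simpa using this
  have hmp := μ.measurePreserving_homeomorphUnitSphereProd
  have hemb := (homeomorphUnitSphereProd V).measurableEmbedding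
  have hfi : Integrable g (μ.toSphere.prod (.volumeIoiPow (Module.finrank ℝ V - 1))) := by
    rw [← hmp.integrable_comp_emb hemb, ← hcomp]
    have : IntegrableOn f {0}ᶜ μ := hf.integrableOn
    exact (integrableOn_iff_comap_subtypeVal (measurableSet_singleton _).compl).1 this
  calc
    ∫ x, f x ∂μ = ∫ x : ({(0)}ᶜ : Set V), f x ∂(μ.comap (↑)) := by
      rw [integral_subtype_comap (measurableSet_singleton _).compl f,
        restrict_compl_singleton]
    _ = ∫ p, g p ∂μ.toSphere.prod (.volumeIoiPow (Module.finrank ℝ V - 1)) := by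
      rw [hcomp]
      exact hmp.integral_comp hemb g
    _ = _ := by
      rw [integral_prod g hfi]
      congr 1
      ext u
      simp only [Measure.volumeIoiPow, ENNReal.ofReal]
      rw [integral_withDensity_eq_integral_smul,
        integral_subtype_comap measurableSet_Ioi fun a : ℝ =>
          Real.toNNReal (a ^ (Module.finrank ℝ V - 1)) • f (a • (u : V)),
        setIntegral_congr_fun measurableSet_Ioi fun x hx ↦ ?_]
      · rw [NNReal.smul_def, Real.coe_toNNReal _ (pow_nonneg (Set.mem_Ioi.1 hx).le _), smul_eq_mul]
      · exact (measurable_subtype_coe.pow_const _).real_toNNReal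

/-- The moments of the half-line Gaussian. -/
def gaussMoment (m : ℕ) : ℝ := ∫ s in Set.Ioi (0 : ℝ), s ^ m * Real.exp (-(s ^ 2 / 2))

theorem integrableOn_pow_mul_exp (m : ℕ) {b : ℝ} (hb : 0 < b) :
    IntegrableOn (fun s : ℝ => s ^ m * Real.exp (-(b * s ^ 2))) (Set.Ioi 0) := by
  refine (integrableOn_rpow_mul_exp_neg_mul_sq hb (s := m)
    (by have := m.cast_nonneg (α := ℝ); linarith)).congr_fun (fun s _ => ?_) measurableSet_Ioi
  simp

theorem gaussMoment_eq (m : ℕ) :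
    gaussMoment m = (1 / 2 : ℝ) ^ (-((m : ℝ) + 1) / 2) * (1 / 2) * Real.Gamma (((m : ℝ) + 1) / 2) := by
  rw [← integral_rpow_mul_exp_neg_mul_rpow two_pos
    (by have := m.cast_nonneg (α := ℝ); linarith) (by norm_num), gaussMoment]
  refine setIntegral_congr_fun measurableSet_Ioi fun s _ => ?_
  simp only [Real.rpow_natCast, Real.rpow_two]
  ring_nf

theorem gaussMoment_pos (m : ℕ) : 0 < gaussMoment m := by
  rw [gaussMoment_eq]
  have : 0 < Real.Gamma (((m : ℝ) + 1) / 2) := Real.Gamma_pos_of_pos (by positivity)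
  positivity

theorem gaussMoment_add_two (m : ℕ) : gaussMoment (m + 2) = (m + 1) * gaussMoment m := by
  have h1 : (((m + 2 : ℕ) : ℝ) + 1) / 2 = ((m : ℝ) + 1) / 2 + 1 := by push_cast; ring
  have h2 : -(((m + 2 : ℕ) : ℝ) + 1) / 2 = -((m : ℝ) + 1) / 2 - 1 := by push_cast; ring
  rw [gaussMoment_eq, gaussMoment_eq, h1, h2, Real.Gamma_add_one (by positivity),
    Real.rpow_sub (by norm_num), Real.rpow_one]
  ring

theorem integral_pow_mul_exp (m : ℕ) {b : ℝ} (hb : 0 < b) :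
    ∫ s in Set.Ioi (0 : ℝ), s ^ m * Real.exp (-((s * b) ^ 2 / 2)) =
      gaussMoment m / b ^ (m + 1) := by
  have h := integral_comp_mul_right_Ioi (fun s : ℝ => s ^ m * Real.exp (-(s ^ 2 / 2))) 0 hb
  simp only [mul_pow, zero_mul] at h
  rw [gaussMoment, eq_div_iff (by positivity)]
  rw [smul_eq_mul, eq_inv_mul_iff_mul_eq₀ hb.ne', ← integral_const_mul] at h
  rw [← h, ← integral_mul_const]
  congr 1
  ext s
  ring_nf

theorem exists_bound_of_homogeneous {n : ℕ} {p : E n → ℝ} {k : ℕ} (hp : ContinuousOn p {0}ᶜ)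
    (hk : ∀ (t : ℝ) (x : E n), 0 < t → x ≠ 0 → p (t • x) = t ^ k * p x) :
    ∃ C : ℝ, 0 ≤ C ∧ ∀ x, x ≠ 0 → |p x| ≤ C * ‖x‖ ^ k := by
  have hne : (sphere (0 : E n) 1).Nonempty := NormedSpace.sphere_nonempty.2 zero_le_one
  have hps : ContinuousOn p (sphere 0 1) :=
    hp.mono fun x hx => ne_zero_of_mem_unit_sphere ⟨x, hx⟩
  obtain ⟨u, hu, hmax⟩ := (isCompact_sphere (0 : E n) 1).exists_isMaxOn hne hps.abs
  refine ⟨|p u|, abs_nonneg _, fun x hx => ?_⟩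
  have hs := inv_norm_smul_mem_sphere hx
  nth_rewrite 1 [← norm_smul_inv_norm_smul hx]
  rw [hk _ _ (norm_pos_iff.2 hx) (ne_zero_of_mem_unit_sphere ⟨_, hs⟩), abs_mul, abs_pow,
    abs_norm, mul_comm]
  exact mul_le_mul_of_nonneg_right (hmax hs) (by positivity)

namespace IsSupport
variable {n : ℕ} {H : E n → ℝ} (hH : IsSupport H)
include hH

theorem integrable_of_homogeneous {p : E n → ℝ} {k : ℕ} (hp : ContinuousOn p {0}ᶜ)
    (hk : ∀ (t : ℝ) (x : E n), 0 < t → x ≠ 0 → p (t • x) = t ^ k * p x) :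
    Integrable fun x => p x * Real.exp (-(H x ^ 2 / 2)) := by
  obtain ⟨C, hC, hbd⟩ := exists_bound_of_homogeneous hp hk
  obtain ⟨a, b, ha, -, hab⟩ := hH.exists_bounds
  have hae : ∀ᵐ x : E n, x ≠ 0 := by
    rw [ae_iff]; simp
  have hmeas : AEStronglyMeasurable p := by
    have := hp.aestronglyMeasurable (μ := volume) (measurableSet_singleton (0 : E n)).compl
    rwa [restrict_compl_singleton] at this
  have hdom : Integrable fun x : E n => C * (‖x‖ ^ k * Real.exp (-(a ^ 2 / 2 * ‖x‖ ^ 2))) := by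
    refine Integrable.const_mul ?_ C
    refine (integrable_fun_norm_addHaar volume
      (f := fun r => r ^ k * Real.exp (-(a ^ 2 / 2 * r ^ 2)))).2 ?_
    refine (integrableOn_pow_mul_exp (Module.finrank ℝ (E n) - 1 + k)
      (b := a ^ 2 / 2) (by positivity)).congr_fun (fun s _ => ?_) measurableSet_Ioi
    simp only [smul_eq_mul]
    ring
  refine hdom.mono' (hmeas.mul ?_) ?_
  · exact (Real.continuous_exp.comp
      (((hH.continuous.pow 2).div_const 2).neg)).aestronglyMeasurable
  · filter_upwards [hae] with x hx
    rw [Real.norm_eq_abs, abs_mul, Real.abs_exp, ← mul_assoc]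
    refine mul_le_mul (hbd x hx) (Real.exp_le_exp.2 ?_) (Real.exp_pos _).le (by positivity)
    have h1 := (hab x).1
    have h2 : (a * ‖x‖) ^ 2 ≤ H x ^ 2 := pow_le_pow_left₀ (by positivity) h1 2
    linarith

theorem integral_of_homogeneous {p : E n → ℝ} {k : ℕ} (hp : ContinuousOn p {0}ᶜ)
    (hk : ∀ (t : ℝ) (x : E n), 0 < t → x ≠ 0 → p (t • x) = t ^ k * p x) :
    ∫ x, p x * Real.exp (-(H x ^ 2 / 2)) =
      gaussMoment (n + k) * ∫ u : sphere (0 : E n) 1, p u / H u ^ (n + k + 1)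
        ∂(volume : Measure (E n)).toSphere := by
  rw [integral_eq_integral_toSphere volume (hH.integrable_of_homogeneous hp hk),
    ← integral_const_mul]
  congr 1
  ext u
  have hu0 : (u : E n) ≠ 0 := ne_zero_of_mem_unit_sphere u
  have h1 : ∀ r ∈ Set.Ioi (0 : ℝ), r ^ (Module.finrank ℝ (E n) - 1) *
      (p (r • (u : E n)) * Real.exp (-(H (r • (u : E n)) ^ 2 / 2))) =
      p u * (r ^ (n + k) * Real.exp (-((r * H u) ^ 2 / 2))) := by
    intro r hr
    rw [hk r u hr hu0, hH.hom r u hr, finrank_euclideanSpace, Fintype.card_fin, Nat.add_sub_cancel]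
    ring
  rw [setIntegral_congr_fun measurableSet_Ioi h1, integral_const_mul,
    integral_pow_mul_exp _ (hH.pos hu0)]
  ring

end IsSupport

theorem exists_second_difference_eq {φ φ' φ'' : ℝ → ℝ} {ε : ℝ} (hε : 0 < ε)
    (h1 : ∀ t, |t| ≤ ε → HasDerivAt φ (φ' t) t) (h2 : ∀ t, |t| ≤ ε → HasDerivAt φ' (φ'' t) t) :
    ∃ η, |η| ≤ ε ∧ φ ε + φ (-ε) - 2 * φ 0 = ε ^ 2 * φ'' η := by
  have hψ : ∀ t, |t| ≤ ε → HasDerivAt (fun s => φ s + φ (-s)) (φ' t - φ' (-t)) t := by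
    intro t ht
    have := (h1 (-t) (by rwa [abs_neg])).comp t (hasDerivAt_neg t)
    simpa [sub_eq_add_neg] using! (h1 t ht).add this
  have habs {t : ℝ} (ht : t ∈ Set.Icc 0 ε) : |t| ≤ ε := by rw [abs_of_nonneg ht.1]; exact ht.2
  obtain ⟨ξ, hξ, h⟩ := exists_ratio_hasDerivAt_eq_ratio_slope (fun s => φ s + φ (-s)) _ hε
    (fun t ht => (hψ t (habs ht)).continuousAt.continuousWithinAt)
    (fun t ht => hψ t (habs (Set.Ioo_subset_Icc_self ht))) (fun s => s ^ 2) (fun s => 2 * s)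
    (by fun_prop) (fun t _ => by simpa using hasDerivAt_pow 2 t)
  have hle {t : ℝ} (ht : t ∈ Set.Icc (-ξ) ξ) : |t| ≤ ε :=
    abs_le.2 ⟨by linarith [ht.1, hξ.2], by linarith [ht.2, hξ.2]⟩
  obtain ⟨η, hη, h'⟩ := exists_hasDerivAt_eq_slope φ' φ'' (show -ξ < ξ by linarith [hξ.1])
    (fun t ht => (h2 t (hle ht)).continuousAt.continuousWithinAt)
    (fun t ht => h2 t (hle (Set.Ioo_subset_Icc_self ht)))
  refine ⟨η, hle (Set.Ioo_subset_Icc_self hη), ?_⟩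
  have hξ0 := hξ.1
  rw [eq_div_iff (by linarith)] at h'
  simp only [neg_zero] at h
  refine mul_right_cancel₀ (b := 2 * ξ) (by positivity) ?_
  linear_combination -h - ε ^ 2 * h'

/-- Half of the second difference of `t ↦ (H (x + t • e) - t * c) ^ 2 / 2`. -/
def secDiff {n : ℕ} (H : E n → ℝ) (e : E n) (c ε : ℝ) (x : E n) : ℝ :=
  ((H (x + ε • e) - ε * c) ^ 2 + (H (x - ε • e) + ε * c) ^ 2) / 4 - H x ^ 2 / 2

/-- The second derivative of `t ↦ (H (x + t • e) - t * c) ^ 2 / 2` at `0`. -/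
def secDeriv {n : ℕ} (H : E n → ℝ) (e : E n) (c : ℝ) (x : E n) : ℝ :=
  (⟪gradient H x, e⟫ - c) ^ 2 + H x * ⟪hess H x e, e⟫

namespace IsSupport
variable {n : ℕ} {H : E n → ℝ} (hH : IsSupport H)
include hH

theorem continuousOn_inner_gradient (e : E n) :
    ContinuousOn (fun x => ⟪gradient H x, e⟫) {(0 : E n)}ᶜ := fun _ hx =>
  ((hH.contDiffAt_gradient hx).continuousAt.inner continuousAt_const).continuousWithinAt

theorem continuousOn_inner_hess (e : E n) :
    ContinuousOn (fun x => ⟪hess H x e, e⟫) {(0 : E n)}ᶜ := fun _ hx =>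
  (((hH.contDiffAt_hess hx).continuousAt.clm_apply continuousAt_const).inner
    continuousAt_const).continuousWithinAt

theorem mul_hess_smul {t : ℝ} (ht : 0 < t) {x : E n} (hx : x ≠ 0) (e : E n) :
    H (t • x) * ⟪hess H (t • x) e, e⟫ = H x * ⟪hess H x e, e⟫ := by
  rw [hH.hom t x ht, ← hH.hess_smul ht hx, smul_apply, real_inner_smul_left]
  ring

theorem exists_secDiff_eq (e : E n) (c : ℝ) {x : E n} {ε : ℝ} (hε : 0 < ε)
    (h0 : ∀ t : ℝ, |t| ≤ ε → x + t • e ≠ 0) : ∃ η, |η| ≤ ε ∧ secDiff H e c ε x =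
      ε ^ 2 * (((⟪gradient H (x + η • e), e⟫ - c) ^ 2 +
        (H (x + η • e) - η * c) * ⟪hess H (x + η • e) e, e⟫) / 2) := by
  have hc (t : ℝ) : HasDerivAt (fun s : ℝ => x + s • e) e t := by
    have := ((hasDerivAt_id t).smul_const e).const_add x
    rwa [one_smul] at this
  have hK (t : ℝ) (ht : |t| ≤ ε) : HasDerivAt (fun s => H (x + s • e) - s * c)
      (⟪gradient H (x + t • e), e⟫ - c) t := by
    have := (hH.hasDerivAt_comp (hc t) (h0 t ht)).sub ((hasDerivAt_id t).mul_const c)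
    rwa [one_mul] at this
  have hX (t : ℝ) (ht : |t| ≤ ε) : HasDerivAt (fun s => ⟪gradient H (x + s • e), e⟫ - c)
      ⟪hess H (x + t • e) e, e⟫ t := by
    have h1 := (hH.hasFDerivAt_gradient (h0 t ht)).comp_hasDerivAt t (hc t)
    have h2 := (h1.inner ℝ (hasDerivAt_const t e)).sub_const c
    rwa [inner_zero_right, zero_add] at h2
  obtain ⟨η, hη, h⟩ := exists_second_difference_eq (φ := fun s => (H (x + s • e) - s * c) ^ 2 / 2)
    (φ' := fun s => (H (x + s • e) - s * c) * (⟪gradient H (x + s • e), e⟫ - c))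
    (φ'' := fun s => (⟪gradient H (x + s • e), e⟫ - c) ^ 2 +
      (H (x + s • e) - s * c) * ⟪hess H (x + s • e) e, e⟫) hε
    (fun t ht => by
      refine (((hK t ht).pow 2).div_const 2).congr_deriv ?_
      simp
      ring)
    (fun t ht => ((hK t ht).mul (hX t ht)).congr_deriv (by ring))
  refine ⟨η, hη, ?_⟩
  simp only [neg_smul, zero_smul, add_zero, ← sub_eq_add_neg, zero_mul, sub_zero, neg_mul,
    sub_neg_eq_add] at h
  rw [secDiff]
  linear_combination h / 2

theorem exists_abs_secDiff_le {e : E n} (he : ‖e‖ = 1) (c : ℝ) :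
    ∃ C : ℝ, 0 ≤ C ∧ ∀ x : E n, ∀ ε : ℝ, 0 < ε → |secDiff H e c ε x| ≤ C * ε ^ 2 := by
  obtain ⟨C₁, hC₁, h₁⟩ := exists_bound_of_homogeneous (k := 0) (hH.continuousOn_inner_gradient e)
    (fun t x ht hx => by rw [hH.gradient_smul ht hx, pow_zero, one_mul])
  obtain ⟨C₂, hC₂, h₂⟩ := exists_bound_of_homogeneous (k := 0)
    (hH.continuous.continuousOn.mul (hH.continuousOn_inner_hess e))
    (fun t x ht hx => by rw [pow_zero, one_mul]; exact hH.mul_hess_smul ht hx e)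
  obtain ⟨a, b, ha, hb, hab⟩ := hH.exists_bounds
  simp only [pow_zero, mul_one, Pi.mul_apply] at h₁ h₂
  set C := (3 * b + |c|) ^ 2 + (2 * b) ^ 2 + ((C₁ + |c|) ^ 2 + (C₂ + |c| * (C₂ / a)))
  have hA : 0 ≤ (C₁ + |c|) ^ 2 + (C₂ + |c| * (C₂ / a)) := by positivity
  refine ⟨C, by positivity, fun x ε hε => ?_⟩
  rcases lt_or_ge ‖x‖ (2 * ε) with hx | hx
  · have hK (s : ℝ) (hs : |s| = ε) : (H (x + s • e) - s * c) ^ 2 ≤ ((3 * b + |c|) * ε) ^ 2 := by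
      refine sq_le_sq' ?_ ?_
      · have := hH.nonneg (x + s • e)
        have h3 : s * c ≤ |c| * ε := by
          rw [← hs, mul_comm, ← abs_mul]; exact le_abs_self _
        nlinarith
      · have h3 : -(s * c) ≤ |c| * ε := by
          rw [← hs, mul_comm, ← abs_mul]; exact neg_le_abs _
        have h4 : ‖x + s • e‖ ≤ 3 * ε := by
          refine (norm_add_le _ _).trans ?_
          rw [norm_smul, he, Real.norm_eq_abs, hs]
          linarith
        have h5 := (hab (x + s • e)).2
        nlinarith
    have h1 := hK ε (abs_of_pos hε)
    have h2 := hK (-ε) (by rw [abs_neg, abs_of_pos hε])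
    simp only [neg_smul, ← sub_eq_add_neg, neg_mul, sub_neg_eq_add] at h2
    have h3 : H x ^ 2 ≤ (2 * b * ε) ^ 2 := by
      refine pow_le_pow_left₀ (hH.nonneg x) ((hab x).2.trans ?_) 2
      nlinarith
    rw [secDiff, abs_le]
    have := sq_nonneg (H (x + ε • e) - ε * c)
    have := sq_nonneg (H (x - ε • e) + ε * c)
    have := sq_nonneg (H x)
    have h6 := mul_nonneg hA (sq_nonneg ε)
    have e1 : C * ε ^ 2 = ((3 * b + |c|) * ε) ^ 2 + (2 * b * ε) ^ 2 +
      ((C₁ + |c|) ^ 2 + (C₂ + |c| * (C₂ / a))) * ε ^ 2 := by ring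
    constructor <;> nlinarith
  · have hn {t : ℝ} (ht : |t| ≤ ε) : ε ≤ ‖x + t • e‖ := by
      have := norm_sub_norm_le x (-(t • e))
      rw [sub_neg_eq_add, norm_neg, norm_smul, he, Real.norm_eq_abs, mul_one] at this
      linarith
    have hn0 {t : ℝ} (ht : |t| ≤ ε) : x + t • e ≠ 0 := norm_pos_iff.1 (hε.trans_le (hn ht))
    obtain ⟨η, hη, h⟩ := hH.exists_secDiff_eq e c hε fun t => hn0
    rw [h, abs_mul, abs_of_nonneg (sq_nonneg ε), mul_comm]
    refine mul_le_mul_of_nonneg_right ?_ (sq_nonneg ε)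
    set z := x + η • e
    have hz : z ≠ 0 := hn0 hη
    have hHz := hH.pos hz
    have h3 : (⟪gradient H z, e⟫ - c) ^ 2 ≤ (C₁ + |c|) ^ 2 := by
      rw [← sq_abs]
      exact pow_le_pow_left₀ (abs_nonneg _) ((abs_sub _ _).trans (by linarith [h₁ z hz])) 2
    have h4 : |(H z - η * c) * ⟪hess H z e, e⟫| ≤ C₂ + |c| * (C₂ / a) := by
      rw [sub_mul]
      refine (abs_sub _ _).trans (add_le_add (h₂ z hz) ?_)
      rw [mul_comm η, mul_assoc, abs_mul]
      refine mul_le_mul_of_nonneg_left ?_ (abs_nonneg c)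
      rw [le_div_iff₀ ha]
      refine le_trans ?_ (h₂ z hz)
      rw [abs_mul, abs_mul, abs_of_pos hHz]
      have h5 : |η| * a ≤ H z := by
        refine le_trans ?_ (hab z).1
        rw [mul_comm]
        exact mul_le_mul_of_nonneg_left (hη.trans (hn hη)) ha.le
      have := mul_le_mul_of_nonneg_right h5 (abs_nonneg ⟪hess H z e, e⟫)
      linarith
    have h6 := abs_le.1 h4
    have : 0 ≤ (3 * b + |c|) ^ 2 + (2 * b) ^ 2 := by positivity
    have := sq_nonneg (⟪gradient H z, e⟫ - c)
    rw [abs_le]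
    constructor <;> linarith

open Filter Topology in
theorem tendsto_secDiff_div (e : E n) (c : ℝ) {x : E n} (hx : x ≠ 0) :
    Tendsto (fun ε => secDiff H e c ε x / ε ^ 2) (𝓝[>] 0) (𝓝 (secDeriv H e c x / 2)) := by
  set q : ℝ → ℝ := fun η => ((⟪gradient H (x + η • e), e⟫ - c) ^ 2 +
    (H (x + η • e) - η * c) * ⟪hess H (x + η • e) e, e⟫) / 2 with hq
  have hline : ContinuousAt (fun η : ℝ => x + η • e) 0 := by fun_prop
  have hx' : x + (0 : ℝ) • e ≠ 0 := by simpa using hx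
  have hopen : ({(0 : E n)}ᶜ : Set (E n)) ∈ 𝓝 (x + (0 : ℝ) • e) :=
    isOpen_compl_singleton.mem_nhds hx'
  have hqc : ContinuousAt q 0 := by
    have h1 : ContinuousAt (fun η : ℝ => ⟪gradient H (x + η • e), e⟫) 0 :=
      ((hH.continuousOn_inner_gradient e).continuousAt hopen).comp
        (f := fun η : ℝ => x + η • e) hline
    have h2 : ContinuousAt (fun η : ℝ => ⟪hess H (x + η • e) e, e⟫) 0 :=
      ((hH.continuousOn_inner_hess e).continuousAt hopen).comp
        (f := fun η : ℝ => x + η • e) hline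
    have h3 : ContinuousAt (fun η : ℝ => H (x + η • e)) 0 :=
      hH.continuous.continuousAt.comp (f := fun η : ℝ => x + η • e) hline
    exact (((h1.sub_const c).pow 2).add
      ((h3.sub (continuousAt_id.mul continuousAt_const)).mul h2)).div_const 2
  have hq0 : q 0 = secDeriv H e c x / 2 := by simp [hq, secDeriv]
  rw [← hq0]
  rw [Metric.tendsto_nhds]
  intro δ hδ
  have h1 : ∀ᶠ η in 𝓝 (0 : ℝ), dist (q η) (q 0) < δ ∧ x + η • e ≠ 0 :=
    (Metric.tendsto_nhds.1 hqc δ hδ).and (hline.preimage_mem_nhds hopen)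
  obtain ⟨r, hr, h2⟩ := Metric.eventually_nhds_iff.1 h1
  filter_upwards [Ioo_mem_nhdsGT hr] with ε hε
  have h3 {t : ℝ} (ht : |t| ≤ ε) := h2 (y := t) (by
    rw [Real.dist_eq, sub_zero]; exact ht.trans_lt hε.2)
  obtain ⟨η, hη, h⟩ := hH.exists_secDiff_eq e c hε.1 fun t ht => (h3 ht).2
  rw [h, mul_div_cancel_left₀ _ (pow_ne_zero 2 hε.1.ne')]
  exact (h3 hη).1

end IsSupport

theorem cubic_le_exp (s : ℝ) : 1 + s + s ^ 2 / 2 + s ^ 3 / 6 ≤ Real.exp s := by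
  set u : ℝ → ℝ := fun s => (1 + s + s ^ 2 / 2 + s ^ 3 / 6) * Real.exp (-s) with hu
  have hd (s : ℝ) : HasDerivAt u (-(s ^ 3 / 6) * Real.exp (-s)) s := by
    have h1 := (((hasDerivAt_id s).const_add 1).add ((hasDerivAt_pow 2 s).div_const 2)).add
      ((hasDerivAt_pow 3 s).div_const 6)
    have h2 := (Real.hasDerivAt_exp (-s)).comp s (hasDerivAt_neg s)
    refine (h1.mul h2).congr_deriv ?_
    simp
    ring
  have hc : Continuous u := continuous_iff_continuousAt.2 fun s => (hd s).continuousAt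
  have hle : u s ≤ u 0 := by
    rcases le_total 0 s with hs | hs
    · refine antitoneOn_of_deriv_nonpos (convex_Ici 0) hc.continuousOn
        (fun t _ => (hd t).differentiableAt.differentiableWithinAt) (fun t ht => ?_)
        Set.self_mem_Ici hs hs
      rw [(hd t).deriv]
      rw [interior_Ici, Set.mem_Ioi] at ht
      have : 0 ≤ t ^ 3 / 6 * Real.exp (-t) := by positivity
      linarith
    · refine monotoneOn_of_deriv_nonneg (convex_Iic 0) hc.continuousOn
        (fun t _ => (hd t).differentiableAt.differentiableWithinAt) (fun t ht => ?_)
        hs Set.self_mem_Iic hs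
      rw [(hd t).deriv]
      rw [interior_Iic, Set.mem_Iio] at ht
      have : 0 ≤ -(t ^ 3) := by
        have := pow_pos (neg_pos.2 ht) 3
        nlinarith
      have : 0 ≤ -(t ^ 3 / 6) := by linarith
      positivity
  simp only [hu, Real.exp_neg] at hle
  rw [← div_eq_mul_inv, div_le_iff₀ (Real.exp_pos s)] at hle
  simpa using hle

theorem ofReal_integral_le_lintegral {α : Type*} [MeasurableSpace α] {μ : Measure α} {f : α → ℝ}
    (hf : Integrable f μ) : ENNReal.ofReal (∫ x, f x ∂μ) ≤ ∫⁻ x, ENNReal.ofReal (f x) ∂μ := by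
  rw [integral_eq_lintegral_pos_part_sub_lintegral_neg_part hf]
  exact (ENNReal.ofReal_le_ofReal (sub_le_self _ ENNReal.toReal_nonneg)).trans
    ENNReal.ofReal_toReal_le

/-- Prékopa–Leindler for `exp (-φ)` and `exp (-ψ)`, the third function being the smallest possible
one. -/
theorem lintegral_exp_mul_lintegral_exp_le (d : ℕ) {φ ψ : EuclideanSpace ℝ (Fin d) → ℝ}
    (hφ : Continuous φ) (hψ : Continuous ψ) :
    (∫⁻ x, ENNReal.ofReal (Real.exp (-φ x))) * ∫⁻ x, ENNReal.ofReal (Real.exp (-ψ x)) ≤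
      (∫⁻ y, ⨆ z, ENNReal.ofReal (Real.exp (-((φ (y + z) + ψ (y - z)) / 2)))) ^ 2 := by
  refine prekopaLeindler d (by fun_prop) (by fun_prop) ?_ fun x y => ?_
  · refine (lowerSemicontinuous_iSup fun z => ?_).measurable
    refine Continuous.lowerSemicontinuous ?_
    exact ENNReal.continuous_ofReal.comp (by fun_prop)
  · have h1 : (2⁻¹ : ℝ) • (x + y) + (2⁻¹ : ℝ) • (x - y) = x := by module
    have h2 : (2⁻¹ : ℝ) • (x + y) - (2⁻¹ : ℝ) • (x - y) = y := by module
    calc _ = ENNReal.ofReal (Real.exp (-((φ x + ψ y) / 2))) ^ 2 := by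
          rw [← ENNReal.ofReal_mul (Real.exp_pos _).le, ← ENNReal.ofReal_pow (Real.exp_pos _).le,
            ← Real.exp_add, ← Real.exp_nat_mul]
          congr 2
          push_cast
          ring
      _ ≤ _ := by
          gcongr
          refine le_iSup_of_le ((2⁻¹ : ℝ) • (x - y)) ?_
          rw [h1, h2]

/-- A function whose gradient at `H x • gradient H x` has the tangential component `c` removed. -/
def centred {n : ℕ} (H : E n → ℝ) (e : E n) (c : ℝ) (x : E n) : ℝ :=
  H x * (⟪gradient H x, e⟫ - c)

namespace IsSupport
variable {n : ℕ} {H : E n → ℝ} (hH : IsSupport H)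
include hH

theorem continuousOn_jacobian : ContinuousOn (jacobian H) {(0 : E n)}ᶜ :=
  fun _ hx => (hH.continuousAt_jacobian hx).continuousWithinAt

theorem continuousOn_centred (e : E n) (c : ℝ) : ContinuousOn (centred H e c) {(0 : E n)}ᶜ :=
  hH.continuous.continuousOn.mul ((hH.continuousOn_inner_gradient e).sub continuousOn_const)

theorem continuousOn_jacobian_mul_centred_pow (e : E n) (c : ℝ) (k : ℕ) :
    ContinuousOn (fun x => jacobian H x * centred H e c x ^ k) {(0 : E n)}ᶜ :=
  hH.continuousOn_jacobian.mul ((hH.continuousOn_centred e c).pow k)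

theorem jacobian_mul_centred_pow_smul (e : E n) (c : ℝ) (k : ℕ) (t : ℝ) (x : E n) (ht : 0 < t)
    (hx : x ≠ 0) : jacobian H (t • x) * centred H e c (t • x) ^ k =
      t ^ k * (jacobian H x * centred H e c x ^ k) := by
  rw [centred, hH.jacobian_smul ht hx, hH.gradient_smul ht hx, hH.hom t x ht, centred, mul_assoc t,
    mul_pow]
  ring

theorem continuousOn_jacobian_mul_secDeriv (e : E n) (c : ℝ) :
    ContinuousOn (fun x => jacobian H x * secDeriv H e c x) {(0 : E n)}ᶜ :=
  hH.continuousOn_jacobian.mul ((((hH.continuousOn_inner_gradient e).sub continuousOn_const).pow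
    2).add (hH.continuous.continuousOn.mul (hH.continuousOn_inner_hess e)))

theorem jacobian_mul_secDeriv_smul (e : E n) (c : ℝ) (t : ℝ) (x : E n) (ht : 0 < t)
    (hx : x ≠ 0) : jacobian H (t • x) * secDeriv H e c (t • x) =
      t ^ 0 * (jacobian H x * secDeriv H e c x) := by
  rw [secDeriv, hH.jacobian_smul ht hx, hH.gradient_smul ht hx, hH.mul_hess_smul ht hx, secDeriv,
    pow_zero, one_mul]

theorem integrable_jacobian_mul_centred_pow (e : E n) (c : ℝ) (k : ℕ) :
    Integrable fun x => jacobian H x * centred H e c x ^ k * Real.exp (-(H x ^ 2 / 2)) :=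
  hH.integrable_of_homogeneous (hH.continuousOn_jacobian_mul_centred_pow e c k)
    (hH.jacobian_mul_centred_pow_smul e c k)

theorem integrable_jacobian :
    Integrable fun x => jacobian H x * Real.exp (-(H x ^ 2 / 2)) := by
  simpa using hH.integrable_jacobian_mul_centred_pow 0 0 0

omit hH in
theorem ae_ne_zero : ∀ᵐ x : E n, x ≠ 0 := by
  rw [ae_iff]; simp

theorem continuous_secDiff (e : E n) (c ε : ℝ) : Continuous (secDiff H e c ε) := by
  have := hH.continuous
  unfold secDiff
  fun_prop

theorem integrable_jacobian_mul_exp_secDiff {e : E n} (he : ‖e‖ = 1) (c : ℝ) {ε : ℝ} (hε : 0 < ε) :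
    Integrable fun x =>
      jacobian H x * Real.exp (-(H x ^ 2 / 2)) * Real.exp (secDiff H e c ε x) := by
  obtain ⟨C, -, hC⟩ := hH.exists_abs_secDiff_le he c
  refine hH.integrable_jacobian.mul_bdd (c := Real.exp (C * ε ^ 2))
    (Real.continuous_exp.comp (hH.continuous_secDiff e c ε)).aestronglyMeasurable
    (.of_forall fun x => ?_)
  rw [Real.norm_eq_abs, Real.abs_exp]
  exact Real.exp_le_exp.2 ((le_abs_self _).trans (hC x ε hε))

theorem lintegral_mul_lintegral_le (e : E n) (c : ℝ) (ε : ℝ) :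
    (∫⁻ x, ENNReal.ofReal (jacobian H x * Real.exp (-(H x ^ 2 / 2)) *
        Real.exp (ε * centred H e c x))) *
      ∫⁻ x, ENNReal.ofReal (jacobian H x * Real.exp (-(H x ^ 2 / 2)) *
        Real.exp (-(ε * centred H e c x))) ≤
      (∫⁻ x, ENNReal.ofReal (jacobian H x * Real.exp (-(H x ^ 2 / 2)) *
        Real.exp (secDiff H e c ε x))) ^ 2 := by
  obtain ⟨N, hNc, hN, hNG, -⟩ := hH.exists_dual
  set g : E n → ℝ := fun y => ⟪y, e⟫ - c * N y with hg
  have hgG {x : E n} (hx : x ≠ 0) : g (H x • gradient H x) = centred H e c x := by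
    simp only [hg, hNG x hx, real_inner_smul_left, centred]
    ring
  have key := lintegral_exp_mul_lintegral_exp_le (n + 1)
    (φ := fun y => N y ^ 2 / 2 - ε * g y) (ψ := fun y => N y ^ 2 / 2 + ε * g y)
    (by fun_prop) (by fun_prop)
  rw [hH.lintegral_eq_lintegral_jacobian_mul
      (fun y => ENNReal.ofReal (Real.exp (-(N y ^ 2 / 2 - ε * g y)))),
    hH.lintegral_eq_lintegral_jacobian_mul
      (fun y => ENNReal.ofReal (Real.exp (-(N y ^ 2 / 2 + ε * g y)))),
    hH.lintegral_eq_lintegral_jacobian_mul (fun y => ⨆ z, _)] at key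
  refine le_trans (le_of_eq ?_) (key.trans ?_)
  · congr 1 <;> refine lintegral_congr_ae ?_ <;> filter_upwards [ae_ne_zero] with x hx
    · rw [← ENNReal.ofReal_mul (hH.jacobian_pos hx).le, mul_assoc, ← Real.exp_add, hgG hx, hNG x hx]
      congr 3
      ring
    · rw [← ENNReal.ofReal_mul (hH.jacobian_pos hx).le, mul_assoc, ← Real.exp_add, hgG hx, hNG x hx]
      congr 3
      ring
  · gcongr ?_ ^ 2
    refine lintegral_mono_ae ?_
    filter_upwards [ae_ne_zero] with x hx
    rw [mul_assoc, ← Real.exp_add, ENNReal.ofReal_mul (hH.jacobian_pos hx).le]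
    gcongr
    refine iSup_le fun z => ENNReal.ofReal_le_ofReal (Real.exp_le_exp.2 ?_)
    have h0 (s : ℝ) (y : E n) :
        ⟪y, x⟫ - (H (x + s • e) - s * c) ^ 2 / 2 ≤ N y ^ 2 / 2 - s * g y := by
      have h1 := hN y (x + s • e)
      rw [inner_add_right, real_inner_smul_right] at h1
      simp only [hg]
      nlinarith [sq_nonneg (N y - (H (x + s • e) - s * c))]
    have h1 := h0 ε (H x • gradient H x + z)
    have h2 := h0 (-ε) (H x • gradient H x - z)
    rw [inner_add_left, real_inner_smul_left, hH.inner_gradient_self hx] at h1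
    rw [inner_sub_left, real_inner_smul_left, hH.inner_gradient_self hx, neg_smul,
      ← sub_eq_add_neg, neg_mul, neg_mul, sub_neg_eq_add, sub_neg_eq_add] at h2
    rw [secDiff]
    linarith

theorem ofReal_le_lintegral_exp (e : E n) (c : ℝ) (ε : ℝ) :
    ENNReal.ofReal ((∫ x, jacobian H x * centred H e c x ^ 0 * Real.exp (-(H x ^ 2 / 2))) +
      ε * (∫ x, jacobian H x * centred H e c x ^ 1 * Real.exp (-(H x ^ 2 / 2))) +
      ε ^ 2 / 2 * (∫ x, jacobian H x * centred H e c x ^ 2 * Real.exp (-(H x ^ 2 / 2))) +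
      ε ^ 3 / 6 * (∫ x, jacobian H x * centred H e c x ^ 3 * Real.exp (-(H x ^ 2 / 2)))) ≤
    ∫⁻ x, ENNReal.ofReal (jacobian H x * Real.exp (-(H x ^ 2 / 2)) *
        Real.exp (ε * centred H e c x)) := by
  have hi := hH.integrable_jacobian_mul_centred_pow e c
  have h1 := (hi 1).const_mul ε
  have h2 := (hi 2).const_mul (ε ^ 2 / 2)
  have h3 := (hi 3).const_mul (ε ^ 3 / 6)
  rw [← integral_const_mul, ← integral_const_mul, ← integral_const_mul,
    ← integral_add' (hi 0) h1, ← integral_add' ((hi 0).add h1) h2,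
    ← integral_add' (((hi 0).add h1).add h2) h3]
  refine (ofReal_integral_le_lintegral ((((hi 0).add h1).add h2).add h3)).trans
    (lintegral_mono_ae ?_)
  filter_upwards [ae_ne_zero] with x hx
  refine ENNReal.ofReal_le_ofReal ?_
  have := mul_le_mul_of_nonneg_left (cubic_le_exp (ε * centred H e c x))
    (mul_pos (hH.jacobian_pos hx) (Real.exp_pos (-(H x ^ 2 / 2)))).le
  refine le_trans (le_of_eq ?_) this
  simp only [Pi.add_apply]
  ring

theorem integral_jacobian_pos : 0 < ∫ x, jacobian H x * Real.exp (-(H x ^ 2 / 2)) := by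
  have hpos {x : E n} (hx : x ≠ 0) : 0 < jacobian H x * Real.exp (-(H x ^ 2 / 2)) :=
    mul_pos (hH.jacobian_pos hx) (Real.exp_pos _)
  rw [integral_pos_iff_support_of_nonneg_ae
    (by filter_upwards [ae_ne_zero] with x hx using (hpos hx).le) hH.integrable_jacobian]
  refine (isOpen_compl_singleton.measure_pos volume ?_).trans_le
    (measure_mono (s := {(0 : E n)}ᶜ) fun x hx => (hpos hx).ne')
  exact ⟨EuclideanSpace.single 0 1, by simp⟩

/-- The average over the weight `exp (-(H ^ 2 / 2))` of the increment of `exp (secDiff …)`. -/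
theorem tendsto_integral_exp_secDiff {e : E n} (he : ‖e‖ = 1) (c : ℝ) :
    Filter.Tendsto (fun ε : ℝ => ∫ x, jacobian H x * Real.exp (-(H x ^ 2 / 2)) *
        ((Real.exp (secDiff H e c ε x) - 1) / ε ^ 2)) (nhdsWithin 0 (Set.Ioi 0))
      (nhds (∫ x, jacobian H x * Real.exp (-(H x ^ 2 / 2)) * (secDeriv H e c x / 2))) := by
  obtain ⟨C, hC0, hC⟩ := hH.exists_abs_secDiff_le he c
  have hsmall : ∀ᶠ ε : ℝ in nhdsWithin 0 (Set.Ioi 0), C * ε ^ 2 ≤ 1 := by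
    have : Filter.Tendsto (fun ε : ℝ => C * ε ^ 2) (nhds 0) (nhds (C * 0 ^ 2)) :=
      (by fun_prop : Continuous fun ε : ℝ => C * ε ^ 2).tendsto 0
    exact nhdsWithin_le_nhds (this.eventually_le_const (by norm_num))
  refine tendsto_integral_filter_of_dominated_convergence
    (fun x => jacobian H x * Real.exp (-(H x ^ 2 / 2)) * (2 * C)) ?_ ?_
    (hH.integrable_jacobian.mul_const _) ?_
  · refine .of_forall fun ε => hH.integrable_jacobian.aestronglyMeasurable.mul ?_
    have := hH.continuous_secDiff e c ε
    exact (by fun_prop : Continuous fun x =>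
      (Real.exp (secDiff H e c ε x) - 1) / ε ^ 2).aestronglyMeasurable
  · filter_upwards [hsmall, self_mem_nhdsWithin] with ε hε hε0
    filter_upwards [ae_ne_zero] with x hx
    have hε2 : 0 < ε ^ 2 := pow_pos hε0 2
    rw [norm_mul, Real.norm_of_nonneg (mul_pos (hH.jacobian_pos hx) (Real.exp_pos _)).le]
    refine mul_le_mul_of_nonneg_left ?_ (mul_pos (hH.jacobian_pos hx) (Real.exp_pos _)).le
    rw [norm_div, Real.norm_of_nonneg hε2.le, div_le_iff₀ hε2, Real.norm_eq_abs]
    have h1 := hC x ε hε0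
    have h2 := Real.abs_exp_sub_one_le (h1.trans hε)
    linarith
  · filter_upwards [ae_ne_zero] with x hx
    refine Filter.Tendsto.const_mul _ ?_
    have hlim := hH.tendsto_secDiff_div e c hx
    have herr : Filter.Tendsto
        (fun ε : ℝ => (Real.exp (secDiff H e c ε x) - 1 - secDiff H e c ε x) / ε ^ 2)
        (nhdsWithin 0 (Set.Ioi 0)) (nhds 0) := by
      have h0 : Filter.Tendsto (fun ε : ℝ => C ^ 2 * ε ^ 2) (nhdsWithin 0 (Set.Ioi 0))
          (nhds 0) := by
        have := (by fun_prop : Continuous fun ε : ℝ => C ^ 2 * ε ^ 2).tendsto 0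
        simpa using this.mono_left nhdsWithin_le_nhds
      refine squeeze_zero_norm' ?_ h0
      filter_upwards [hsmall, self_mem_nhdsWithin] with ε hε hε0
      have hε2 : 0 < ε ^ 2 := pow_pos hε0 2
      rw [norm_div, Real.norm_of_nonneg hε2.le, div_le_iff₀ hε2, Real.norm_eq_abs]
      have h1 := hC x ε hε0
      refine (Real.abs_exp_sub_one_sub_id_le (h1.trans hε)).trans ?_
      rw [← sq_abs]
      calc |secDiff H e c ε x| ^ 2 ≤ (C * ε ^ 2) ^ 2 := by gcongr
        _ = _ := by ring
    have := hlim.add herr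
    rw [add_zero] at this
    refine this.congr fun ε => ?_
    rw [← add_div]
    congr 1
    ring

/-- A Brascamp–Lieb inequality for the measure pulled back to the dual variable. -/
theorem integral_centred_sq_le {e : E n} (he : ‖e‖ = 1) (c : ℝ)
    (hB : ∫ x, jacobian H x * centred H e c x ^ 1 * Real.exp (-(H x ^ 2 / 2)) = 0) :
    ∫ x, jacobian H x * centred H e c x ^ 2 * Real.exp (-(H x ^ 2 / 2)) ≤
      ∫ x, jacobian H x * secDeriv H e c x * Real.exp (-(H x ^ 2 / 2)) := by
  set A := ∫ x, jacobian H x * centred H e c x ^ 0 * Real.exp (-(H x ^ 2 / 2)) with hA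
  set C := ∫ x, jacobian H x * centred H e c x ^ 2 * Real.exp (-(H x ^ 2 / 2))
  set D := ∫ x, jacobian H x * centred H e c x ^ 3 * Real.exp (-(H x ^ 2 / 2))
  set R : ℝ → ℝ := fun ε => ∫ x, jacobian H x * Real.exp (-(H x ^ 2 / 2)) *
        ((Real.exp (secDiff H e c ε x) - 1) / ε ^ 2) with hR
  have hA' : A = ∫ x, jacobian H x * Real.exp (-(H x ^ 2 / 2)) := by simp [hA]
  have hA0 : 0 < A := hA' ▸ hH.integral_jacobian_pos
  have hlim := hH.tendsto_integral_exp_secDiff he c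
  rw [← hR] at hlim
  have hR0 : ∫ x, jacobian H x * Real.exp (-(H x ^ 2 / 2)) * (secDeriv H e c x / 2) =
      (∫ x, jacobian H x * secDeriv H e c x * Real.exp (-(H x ^ 2 / 2))) / 2 := by
    rw [← integral_div]
    congr 1 with x
    ring
  rw [hR0] at hlim
  have hlow (ε : ℝ) := hH.ofReal_le_lintegral_exp e c ε
  simp only [hB, ← hA] at hlow
  have hapos : ∀ᶠ ε : ℝ in nhdsWithin 0 (Set.Ioi 0),
      0 ≤ A + ε * 0 + ε ^ 2 / 2 * C + ε ^ 3 / 6 * D := by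
    have : Filter.Tendsto (fun ε : ℝ => A + ε * 0 + ε ^ 2 / 2 * C + ε ^ 3 / 6 * D) (nhds 0)
        (nhds (A + 0 * 0 + 0 ^ 2 / 2 * C + 0 ^ 3 / 6 * D)) :=
      (by fun_prop : Continuous fun ε : ℝ =>
        A + ε * 0 + ε ^ 2 / 2 * C + ε ^ 3 / 6 * D).tendsto 0
    exact nhdsWithin_le_nhds (this.eventually_const_le (by simpa using hA0))
  have hineq : ∀ᶠ ε : ℝ in nhdsWithin 0 (Set.Ioi 0),
      A * C + ε ^ 2 * (C ^ 2 / 4) - ε ^ 4 * (D ^ 2 / 36) ≤ 2 * A * R ε + ε ^ 2 * R ε ^ 2 := by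
    filter_upwards [hapos, self_mem_nhdsWithin] with ε ha hε0
    have hε2 : 0 < ε ^ 2 := pow_pos hε0 2
    have hJi := hH.integrable_jacobian_mul_exp_secDiff he c hε0
    have hJ : ∫ x, jacobian H x * Real.exp (-(H x ^ 2 / 2)) * Real.exp (secDiff H e c ε x) =
        A + ε ^ 2 * R ε := by
      have h1 : ε ^ 2 * R ε = ∫ x, (jacobian H x * Real.exp (-(H x ^ 2 / 2)) *
          Real.exp (secDiff H e c ε x) - jacobian H x * Real.exp (-(H x ^ 2 / 2))) := by
        rw [hR, ← integral_const_mul]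
        congr 1 with x
        field_simp [hε2.ne', (show ε ≠ 0 from ne_of_gt hε0)]
      rw [h1, integral_sub hJi hH.integrable_jacobian, hA']
      ring
    have hJ0 : 0 ≤ᵐ[volume] fun x => jacobian H x * Real.exp (-(H x ^ 2 / 2)) *
        Real.exp (secDiff H e c ε x) := by
      filter_upwards [ae_ne_zero] with x hx
      exact (mul_pos (mul_pos (hH.jacobian_pos hx) (Real.exp_pos _)) (Real.exp_pos _)).le
    have hprod := hH.lintegral_mul_lintegral_le e c ε
    rw [← ofReal_integral_eq_lintegral_ofReal hJi hJ0] at hprod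
    have hlow' := hlow (-ε)
    simp only [neg_mul] at hlow'
    have h2 := (mul_le_mul' (hlow ε) hlow').trans hprod
    rw [← ENNReal.ofReal_mul ha, ← ENNReal.ofReal_pow (integral_nonneg_of_ae hJ0),
      ENNReal.ofReal_le_ofReal_iff (sq_nonneg _), hJ] at h2
    refine le_of_mul_le_mul_left ?_ hε2
    nlinarith [h2]
  have hcont : Filter.Tendsto (fun ε : ℝ => A * C + ε ^ 2 * (C ^ 2 / 4) - ε ^ 4 * (D ^ 2 / 36))
      (nhdsWithin 0 (Set.Ioi 0)) (nhds (A * C)) := by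
    have := (by fun_prop : Continuous fun ε : ℝ =>
      A * C + ε ^ 2 * (C ^ 2 / 4) - ε ^ 4 * (D ^ 2 / 36)).tendsto 0
    simpa using this.mono_left nhdsWithin_le_nhds
  have hsq : Filter.Tendsto (fun ε : ℝ => ε ^ 2) (nhdsWithin 0 (Set.Ioi 0)) (nhds 0) := by
    have := (continuous_pow 2 : Continuous fun ε : ℝ => ε ^ 2).tendsto 0
    simpa using this.mono_left nhdsWithin_le_nhds
  have hfin := le_of_tendsto_of_tendsto hcont ((hlim.const_mul (2 * A)).add
    (hsq.mul (hlim.pow 2))) hineq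
  refine le_of_mul_le_mul_left ?_ hA0
  linarith

theorem integral_jacobian_mul_centred_pow (e : E n) (c : ℝ) (k : ℕ) :
    ∫ x, jacobian H x * centred H e c x ^ k * Real.exp (-(H x ^ 2 / 2)) =
      gaussMoment (n + k) * ∫ u : sphere (0 : E n) 1,
        (⟪gradient H u, e⟫ - c) ^ k * (H u * sigmaDet H u)
          ∂(volume : Measure (E n)).toSphere := by
  rw [hH.integral_of_homogeneous (hH.continuousOn_jacobian_mul_centred_pow e c k)
    (hH.jacobian_mul_centred_pow_smul e c k)]
  congr 2 with u
  have h0 := (hH.pos_sphere u u.2).ne'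
  rw [hH.jacobian_eq u.2, centred, mul_pow]
  field_simp
  ring

theorem integral_jacobian_mul_secDeriv (e : E n) (c : ℝ) :
    ∫ x, jacobian H x * secDeriv H e c x * Real.exp (-(H x ^ 2 / 2)) =
      gaussMoment n * ∫ u : sphere (0 : E n) 1,
        ((⟪gradient H u, e⟫ - c) ^ 2 + H u * ⟪hess H u e, e⟫) * (H u * sigmaDet H u)
          ∂(volume : Measure (E n)).toSphere := by
  rw [hH.integral_of_homogeneous (hH.continuousOn_jacobian_mul_secDeriv e c)
    (hH.jacobian_mul_secDeriv_smul e c)]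
  congr 2 with u
  have h0 := (hH.pos_sphere u u.2).ne'
  rw [hH.jacobian_eq u.2, secDeriv]
  field_simp
  ring

theorem continuousOn_sigmaDet : ContinuousOn (sigmaDet H) (sphere 0 1) := by
  have hsub : sphere (0 : E n) 1 ⊆ {0}ᶜ := fun u hu => ne_zero_of_mem_unit_sphere ⟨u, hu⟩
  refine ((hH.continuousOn_jacobian.mono hsub).div ((hH.continuous.continuousOn).pow (n + 2))
    fun u hu => (pow_pos (hH.pos_sphere u hu) _).ne').congr fun u hu => ?_
  rw [Pi.div_apply, Pi.pow_apply, hH.jacobian_eq hu, mul_div_cancel_left₀ _ (pow_pos (hH.pos_sphere u hu) _).ne']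

theorem continuousOn_gradient : ContinuousOn (gradient H) (sphere 0 1) := fun u hu =>
  (hH.contDiffAt_gradient (ne_zero_of_mem_unit_sphere ⟨u, hu⟩)).continuousAt.continuousWithinAt

theorem continuousOn_hess : ContinuousOn (hess H) (sphere 0 1) := fun u hu =>
  (hH.contDiffAt_hess (ne_zero_of_mem_unit_sphere ⟨u, hu⟩)).continuousAt.continuousWithinAt

theorem continuousOn_coneDensity :
    ContinuousOn (fun u => H u * sigmaDet H u) (sphere (0 : E n) 1) :=
  hH.continuous.continuousOn.mul hH.continuousOn_sigmaDet

omit hH in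
theorem integrable_of_continuousOn_sphere {F : Type*} [NormedAddCommGroup F] {f : E n → F}
    (hf : ContinuousOn f (sphere 0 1)) :
    Integrable (fun u : sphere (0 : E n) 1 => f u) (volume : Measure (E n)).toSphere :=
  (continuousOn_iff_continuous_domRestrict.1 hf).integrable_of_hasCompactSupport
    (HasCompactSupport.of_compactSpace _)

theorem integrable_mul_coneDensity {f : E n → ℝ} (hf : ContinuousOn f (sphere 0 1)) :
    Integrable (fun u : sphere (0 : E n) 1 => f u * (H u * sigmaDet H u))
      (volume : Measure (E n)).toSphere :=
  integrable_of_continuousOn_sphere (hf.mul hH.continuousOn_coneDensity)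

/-- The spectral Brunn–Minkowski inequality for the test function `⟪gradient H, e⟫ - c`. -/
theorem mul_integral_sq_le {e : E n} (he : ‖e‖ = 1) {c : ℝ}
    (hc : ∫ u : sphere (0 : E n) 1, (⟪gradient H u, e⟫ - c) * (H u * sigmaDet H u)
      ∂(volume : Measure (E n)).toSphere = 0) :
    n * ∫ u : sphere (0 : E n) 1, (⟪gradient H u, e⟫ - c) ^ 2 * (H u * sigmaDet H u)
        ∂(volume : Measure (E n)).toSphere ≤
      ∫ u : sphere (0 : E n) 1, H u * ⟪hess H u e, e⟫ * (H u * sigmaDet H u)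
        ∂(volume : Measure (E n)).toSphere := by
  have h1 := hH.integral_centred_sq_le he c (by
    rw [hH.integral_jacobian_mul_centred_pow]
    simp only [pow_one, hc, mul_zero])
  have hX : ContinuousOn (fun u => (⟪gradient H u, e⟫ - c) ^ 2) (sphere (0 : E n) 1) :=
    ((hH.continuousOn_gradient.inner continuousOn_const).sub continuousOn_const).pow 2
  have hT : ContinuousOn (fun u => H u * ⟪hess H u e, e⟫) (sphere (0 : E n) 1) :=
    hH.continuous.continuousOn.mul
      ((hH.continuousOn_hess.clm_apply continuousOn_const).inner continuousOn_const)
  rw [hH.integral_jacobian_mul_centred_pow, hH.integral_jacobian_mul_secDeriv,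
    gaussMoment_add_two] at h1
  simp only [add_mul] at h1
  rw [integral_add (hH.integrable_mul_coneDensity hX) (hH.integrable_mul_coneDensity hT)] at h1
  refine le_of_mul_le_mul_left ?_ (gaussMoment_pos n)
  linarith

/-- The inequality for the spherical measure, one coordinate at a time. -/
theorem mul_integral_inner_sq_le {e : E n} (he : ‖e‖ = 1) :
    n * ∫ u : sphere (0 : E n) 1, ⟪gradient H u, e⟫ ^ 2 * (H u * sigmaDet H u)
        ∂(volume : Measure (E n)).toSphere ≤
      (∫ u : sphere (0 : E n) 1, H u * ⟪hess H u e, e⟫ * (H u * sigmaDet H u)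
        ∂(volume : Measure (E n)).toSphere) +
      n * ⟪∫ u : sphere (0 : E n) 1, (H u * sigmaDet H u) • gradient H u
        ∂(volume : Measure (E n)).toSphere, e⟫ ^ 2 /
      ∫ u : sphere (0 : E n) 1, H u * sigmaDet H u ∂(volume : Measure (E n)).toSphere := by
  set V := ∫ u : sphere (0 : E n) 1, H u * sigmaDet H u ∂(volume : Measure (E n)).toSphere
    with hV
  set M := ⟪∫ u : sphere (0 : E n) 1, (H u * sigmaDet H u) • gradient H u
        ∂(volume : Measure (E n)).toSphere, e⟫ with hM
  have hw := integrable_of_continuousOn_sphere hH.continuousOn_coneDensity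
  have hV0 : 0 < V := by
    have := hH.integral_jacobian_mul_centred_pow 0 0 0
    simp only [pow_zero, mul_one, one_mul, ← hV] at this
    exact pos_of_mul_pos_right (this ▸ hH.integral_jacobian_pos) (gaussMoment_pos _).le
  have hX : ContinuousOn (fun u => ⟪gradient H u, e⟫) (sphere (0 : E n) 1) :=
    hH.continuousOn_gradient.inner continuousOn_const
  have hX2 : ContinuousOn (fun u => ⟪gradient H u, e⟫ ^ 2) (sphere (0 : E n) 1) := hX.pow 2
  have hwX : ContinuousOn (fun u => (H u * sigmaDet H u) • gradient H u) (sphere (0 : E n) 1) :=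
    hH.continuousOn_coneDensity.smul hH.continuousOn_gradient
  have hXc : ContinuousOn (fun u => ⟪gradient H u, e⟫ - M / V) (sphere (0 : E n) 1) :=
    hX.sub continuousOn_const
  have h1 := hH.integrable_mul_coneDensity hX
  have h2 := hH.integrable_mul_coneDensity hX2
  have hM' : ∫ u : sphere (0 : E n) 1, ⟪gradient H u, e⟫ * (H u * sigmaDet H u)
      ∂(volume : Measure (E n)).toSphere = M := by
    rw [hM, real_inner_comm, ← integral_inner (integrable_of_continuousOn_sphere hwX)]
    congr 1 with u
    rw [real_inner_smul_right, real_inner_comm, mul_comm]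
  have hc : ∫ u : sphere (0 : E n) 1, (⟪gradient H u, e⟫ - M / V) * (H u * sigmaDet H u)
      ∂(volume : Measure (E n)).toSphere = 0 := by
    simp only [sub_mul]
    rw [integral_sub h1 (hw.const_mul _), integral_const_mul, hM', ← hV]
    field_simp
    ring
  have key := hH.mul_integral_sq_le he hc
  have hexp : ∫ u : sphere (0 : E n) 1, (⟪gradient H u, e⟫ - M / V) ^ 2 * (H u * sigmaDet H u)
      ∂(volume : Measure (E n)).toSphere =
      (∫ u : sphere (0 : E n) 1, ⟪gradient H u, e⟫ ^ 2 * (H u * sigmaDet H u)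
        ∂(volume : Measure (E n)).toSphere) - M ^ 2 / V := by
    have h3 (u : sphere (0 : E n) 1) :
        (⟪gradient H u, e⟫ - M / V) ^ 2 * (H u * sigmaDet H u) =
        ⟪gradient H u, e⟫ ^ 2 * (H u * sigmaDet H u) -
          M / V * (⟪gradient H u, e⟫ * (H u * sigmaDet H u)) -
          M / V * ((⟪gradient H u, e⟫ - M / V) * (H u * sigmaDet H u)) := by ring
    have h4 := hH.integrable_mul_coneDensity hXc
    simp only [h3]
    have h5 : Integrable (fun u : sphere (0 : E n) 1 =>
        ⟪gradient H u, e⟫ ^ 2 * (H u * sigmaDet H u) -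
          M / V * (⟪gradient H u, e⟫ * (H u * sigmaDet H u)))
        (volume : Measure (E n)).toSphere := h2.sub (h1.const_mul _)
    rw [integral_sub h5 (h4.const_mul _), integral_sub h2 (h1.const_mul _),
      integral_const_mul, integral_const_mul, hc, hM']
    ring
  rw [hexp] at key
  have : n * M ^ 2 / V = n * (M ^ 2 / V) := by ring
  linarith

/-- The magic inequality for the spherical measure. -/
theorem mul_integral_norm_sq_le :
    n * ∫ u : sphere (0 : E n) 1, ‖gradient H u‖ ^ 2 * (H u * sigmaDet H u)
        ∂(volume : Measure (E n)).toSphere ≤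
      (∫ u : sphere (0 : E n) 1, H u * LinearMap.trace ℝ (E n) (hess H u).toLinearMap *
        (H u * sigmaDet H u) ∂(volume : Measure (E n)).toSphere) +
      n * ‖∫ u : sphere (0 : E n) 1, (H u * sigmaDet H u) • gradient H u
        ∂(volume : Measure (E n)).toSphere‖ ^ 2 /
      ∫ u : sphere (0 : E n) 1, H u * sigmaDet H u ∂(volume : Measure (E n)).toSphere := by
  set b := EuclideanSpace.basisFun (Fin (n + 1)) ℝ
  have hnorm (v : E n) : ‖v‖ ^ 2 = ∑ i, ⟪v, b i⟫ ^ 2 := by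
    rw [← b.sum_sq_norm_inner_left v]
    simp
  have htr (T : E n →ₗ[ℝ] E n) : LinearMap.trace ℝ (E n) T = ∑ i, ⟪T (b i), b i⟫ := by
    rw [T.trace_eq_sum_inner b]
    simp only [real_inner_comm]
  have hsum := Finset.sum_le_sum fun i (_ : i ∈ Finset.univ) =>
    hH.mul_integral_inner_sq_le (b.norm_eq_one i)
  rw [← Finset.mul_sum, Finset.sum_add_distrib, ← Finset.sum_div, ← Finset.mul_sum, ← hnorm,
    ← integral_finsetSum, ← integral_finsetSum] at hsum
  · simpa only [hnorm (gradient H _), htr, Finset.sum_mul, Finset.mul_sum,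
      ContinuousLinearMap.coe_coe] using hsum
  · intro i _
    exact integrable_of_continuousOn_sphere ((hH.continuous.continuousOn.mul
      ((hH.continuousOn_hess.clm_apply continuousOn_const).inner continuousOn_const)).mul
      hH.continuousOn_coneDensity)
  · intro i _
    exact integrable_of_continuousOn_sphere
      (((hH.continuousOn_gradient.inner continuousOn_const).pow 2).mul hH.continuousOn_coneDensity)

end IsSupport

/-- The main ('magic') inequality, case `k = n`:
`n ∫ |X|² dV ≤ ∫ h(Δ̄h + nh) dV + n |∫ X dV|² / ∫ dV`, where `X = Dh = gradient H`,
`dV = h σ_n dμ` and `Δ̄h + nh = trace D²H`. -/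
theorem stmt11 (n : ℕ) (H : E n → ℝ)
    (hhom : ∀ (t : ℝ) (x : E n), 0 < t → H (t • x) = t * H x)
    (hsmooth : ContDiffOn ℝ (⊤ : ℕ∞) H {(0 : E n)}ᶜ)
    (hpos : ∀ x ∈ sphere (0 : E n) 1, 0 < H x)
    (hconvex : ∀ x ∈ sphere (0 : E n) 1, ∀ v : E n, ⟪v, x⟫ = 0 → v ≠ 0 →
      0 < ⟪(hess H x) v, v⟫) :
    (n : ℝ) * ∫ x in sphere (0 : E n) 1,
        ‖gradient H x‖ ^ 2 * (H x * sigmaDet H x) ∂μH[(n : ℝ)] ≤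
      (∫ x in sphere (0 : E n) 1,
          H x * LinearMap.trace ℝ (E n) (hess H x).toLinearMap *
            (H x * sigmaDet H x) ∂μH[(n : ℝ)]) +
        (n : ℝ) *
          ‖∫ x in sphere (0 : E n) 1, (H x * sigmaDet H x) • gradient H x ∂μH[(n : ℝ)]‖ ^ 2 /
          ∫ x in sphere (0 : E n) 1, H x * sigmaDet H x ∂μH[(n : ℝ)] := by
  have hH : IsSupport H := ⟨hhom, hsmooth, hpos, hconvex⟩
  have hw := hH.continuousOn_coneDensity
  have htr : ContinuousOn (fun x => LinearMap.trace ℝ (E n) (hess H x).toLinearMap)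
      (sphere (0 : E n) 1) :=
    (LinearMap.continuous_of_finiteDimensional (LinearMap.trace ℝ (E n) ∘ₗ
      ContinuousLinearMap.coeLM ℝ)).comp_continuousOn hH.continuousOn_hess
  obtain ⟨c, hc, h⟩ := exists_setIntegral_sphere_eq (V := E n) (n : ℝ) n.cast_nonneg
  rw [h ℝ (fun x => ‖gradient H x‖ ^ 2 * (H x * sigmaDet H x))
      ((hH.continuousOn_gradient.norm.pow 2).mul hw),
    h ℝ (fun x => H x * LinearMap.trace ℝ (E n) (hess H x).toLinearMap * (H x * sigmaDet H x))
      ((hH.continuous.continuousOn.mul htr).mul hw),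
    h (E n) (fun x => (H x * sigmaDet H x) • gradient H x) (hw.smul hH.continuousOn_gradient),
    h ℝ (fun x => H x * sigmaDet H x) hw, norm_smul, Real.norm_of_nonneg hc, smul_eq_mul, smul_eq_mul, smul_eq_mul]
  have key := mul_le_mul_of_nonneg_left hH.mul_integral_norm_sq_le hc
  refine le_of_eq_of_le (by ring) (key.trans (le_of_eq ?_))
  rcases hc.eq_or_lt with rfl | hc
  · simp
  · field_simp

end
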